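/- arXiv:2110.05426 — 10 statements merged into one kernel-verified Lean document; each statement's English description precedes it below -/
import Mathlib

section
/- Let p be a prime and let d ≥ 1 and r ≥ 1 be integers. For every g ∈ GL_d(ℤ_p) with g ≡ 1 mod p^r there exist R, L ∈ GL_d(ℤ_p) such that R is upper triangular unipotent with R ≡ 1 mod p^r, L is lower triangular with L ≡ 1 mod p^r, and g = R·L. -/
theorem iwahori_aux {A : Type*} [CommRing A] (q : A) (hq : ∀ x : A, q ∣ x - 1 → IsUnit x) (n : ℕ) :
    ∀ g : Matrix (Fin n) (Fin n) A, (∀ i j, q ∣ g i j - (1 : Matrix (Fin n) (Fin n) A) i j) →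
    ∃ R L : Matrix (Fin n) (Fin n) A,
      (∀ i j, j < i → R i j = 0) ∧ (∀ i, R i i = 1) ∧
      (∀ i j, q ∣ R i j - (1 : Matrix (Fin n) (Fin n) A) i j) ∧
      (∀ i j, i < j → L i j = 0) ∧
      (∀ i j, q ∣ L i j - (1 : Matrix (Fin n) (Fin n) A) i j) ∧ g = R * L := by
  induction n with
  | zero =>
    intro g _
    exact ⟨1, 1, fun i => i.elim0, fun i => i.elim0, fun i => i.elim0, fun i => i.elim0,
      fun i => i.elim0, by ext i; exact i.elim0⟩
  | succ n ih =>
    intro g hg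
    have hlast := hg (Fin.last n) (Fin.last n)
    rw [Matrix.one_apply_eq] at hlast
    obtain ⟨u, hu⟩ := (hq _ hlast).exists_left_inv
    have hb : ∀ i : Fin n, q ∣ g i.castSucc (Fin.last n) := fun i => by
      have h := hg i.castSucc (Fin.last n)
      rwa [Matrix.one_apply_ne (Fin.castSucc_lt_last i).ne, sub_zero] at h
    have hc : ∀ i : Fin n, q ∣ g (Fin.last n) i.castSucc := fun i => by
      have h := hg (Fin.last n) i.castSucc
      rwa [Matrix.one_apply_ne (Fin.castSucc_lt_last i).ne', sub_zero] at h
    obtain ⟨R, L, h1, h2, h3, h4, h5, h6⟩ := ih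
      (Matrix.of fun i j => g i.castSucc j.castSucc
        - g i.castSucc (Fin.last n) * u * g (Fin.last n) j.castSucc) (fun i j => by
        have h := hg i.castSucc j.castSucc
        have e : (1 : Matrix (Fin (n+1)) (Fin (n+1)) A) i.castSucc j.castSucc
          = (1 : Matrix (Fin n) (Fin n) A) i j := by simp [Matrix.one_apply]
        rw [e] at h
        rw [Matrix.of_apply, sub_right_comm]
        exact dvd_sub h (Dvd.dvd.mul_left (hc j) _))
    refine ⟨Matrix.of fun i j => Fin.lastCases (motive := fun _ => A)
        (Fin.lastCases (motive := fun _ => A) 1 (fun _ => 0) j)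
        (fun i => Fin.lastCases (motive := fun _ => A) (g i.castSucc (Fin.last n) * u)
          (fun j => R i j) j) i,
      Matrix.of fun i j => Fin.lastCases (motive := fun _ => A) (g (Fin.last n) j)
        (fun i => Fin.lastCases (motive := fun _ => A) 0 (fun j => L i j) j) i,
      ?_, ?_, ?_, ?_, ?_, ?_⟩
    · intro i j
      induction i using Fin.lastCases <;> induction j using Fin.lastCases <;> simp
      · intro h; exact absurd h (Fin.castSucc_lt_last _).not_gt
      · exact h1 _ _
    · intro i
      induction i using Fin.lastCases <;> simp [h2]
    · intro i j
      induction i using Fin.lastCases <;> induction j using Fin.lastCases <;>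
        simp [Matrix.one_apply, (Fin.castSucc_lt_last _).ne, (Fin.castSucc_lt_last _).ne']
      · exact Dvd.dvd.mul_right (hb _) _
      · simpa [Matrix.one_apply] using h3 _ _
    · intro i j
      induction i using Fin.lastCases <;> induction j using Fin.lastCases <;> simp
      · intro h; exact absurd h (Fin.castSucc_lt_last _).not_gt
      · exact h4 _ _
    · intro i j
      induction i using Fin.lastCases
      · simpa using hg _ _
      induction j using Fin.lastCases <;>
        simp [Matrix.one_apply, (Fin.castSucc_lt_last _).ne]
      simpa [Matrix.one_apply] using h5 _ _
    · ext i j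
      rw [Matrix.mul_apply, Fin.sum_univ_castSucc]
      induction i using Fin.lastCases with
      | last => simp
      | cast i =>
        induction j using Fin.lastCases with
        | last => simp [mul_assoc, hu]
        | cast j =>
          have h := congrFun (congrFun h6 i) j
          rw [Matrix.mul_apply, Matrix.of_apply] at h
          simp [← h]

/-- Iwahori decomposition of the depth-`r` principal congruence
subgroup of `GL_d(ℤ_p)`: every `g ∈ GL_d(ℤ_p)` with `g ≡ 1 mod p^r` factors as
`g = R · L` with `R` upper triangular unipotent, `R ≡ 1 mod p^r`, and `L` lower
triangular with `L ≡ 1 mod p^r`. -/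
theorem stmt0 (p : ℕ) [Fact p.Prime] (d r : ℕ) (hd : 1 ≤ d) (hr : 1 ≤ r)
    (g : GL (Fin d) ℤ_[p])
    (hg : ∀ i j : Fin d, (p : ℤ_[p]) ^ r ∣
      ((g : Matrix (Fin d) (Fin d) ℤ_[p]) i j - (1 : Matrix (Fin d) (Fin d) ℤ_[p]) i j)) :
    ∃ R L : GL (Fin d) ℤ_[p],
      (∀ i j : Fin d, j < i → (R : Matrix (Fin d) (Fin d) ℤ_[p]) i j = 0) ∧
      (∀ i : Fin d, (R : Matrix (Fin d) (Fin d) ℤ_[p]) i i = 1) ∧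
      (∀ i j : Fin d, (p : ℤ_[p]) ^ r ∣
        ((R : Matrix (Fin d) (Fin d) ℤ_[p]) i j - (1 : Matrix (Fin d) (Fin d) ℤ_[p]) i j)) ∧
      (∀ i j : Fin d, i < j → (L : Matrix (Fin d) (Fin d) ℤ_[p]) i j = 0) ∧
      (∀ i j : Fin d, (p : ℤ_[p]) ^ r ∣
        ((L : Matrix (Fin d) (Fin d) ℤ_[p]) i j - (1 : Matrix (Fin d) (Fin d) ℤ_[p]) i j)) ∧
      g = R * L := by
  have hq : ∀ x : ℤ_[p], (p : ℤ_[p]) ^ r ∣ x - 1 → IsUnit x := by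
    intro x hx
    by_contra hn
    have hx' : x ∈ nonunits ℤ_[p] := hn
    have hp : (p : ℤ_[p]) ∣ x - 1 := (dvd_pow_self _ (by omega)).trans hx
    have hpx : (p : ℤ_[p]) ∣ x := by
      rw [← Ideal.mem_span_singleton, ← PadicInt.maximalIdeal_eq_span_p]
      exact (IsLocalRing.mem_maximalIdeal x).2 hx'
    have h1 : (p : ℤ_[p]) ∣ 1 := by simpa using dvd_sub hpx hp
    exact PadicInt.prime_p.not_isUnit (isUnit_of_dvd_one h1)
  obtain ⟨R, L, h1, h2, h3, h4, h5, h6⟩ := iwahori_aux _ hq d g.val hg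
  have hdet : IsUnit (R.det * L.det) := by
    rw [← Matrix.det_mul, ← h6]
    exact (Matrix.isUnit_iff_isUnit_det _).1 g.isUnit
  obtain ⟨R', rfl⟩ := (Matrix.isUnit_iff_isUnit_det R).2 (isUnit_of_mul_isUnit_left hdet)
  obtain ⟨L', rfl⟩ := (Matrix.isUnit_iff_isUnit_det L).2 (isUnit_of_mul_isUnit_right hdet)
  exact ⟨R', L', h1, h2, h3, h4, h5, Units.ext h6⟩
end

section
/- Let p be a prime and let d ≥ 1 and r ≥ 1 be integers. Let ξ = w_d be the d×d antidiagonal matrix over ℤ_p and let Y ∈ M_d(ℤ_p) be a matrix all of whose entries lie in p^r·ℤ_p. Then there exist R, S ∈ GL_d(ℤ_p) such that R is upper triangular unipotent with R ≡ 1 mod p^r, S is upper triangular with S ≡ 1 mod p^r, and ξ + Y = R·ξ·S. -/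
theorem aux_lu {A : Type*} [CommRing A] (q : A) (hq : ∀ x, q ∣ x - 1 → IsUnit x) (n : ℕ) :
    ∀ M : Matrix (Fin n) (Fin n) A, (∀ i j, q ∣ M i j - (1 : Matrix (Fin n) (Fin n) A) i j) →
    ∃ L U : Matrix (Fin n) (Fin n) A, (∀ i j, i < j → L i j = 0) ∧ (∀ i, L i i = 1) ∧
      (∀ i j, q ∣ L i j - (1 : Matrix (Fin n) (Fin n) A) i j) ∧
      (∀ i j, j < i → U i j = 0) ∧
      (∀ i j, q ∣ U i j - (1 : Matrix (Fin n) (Fin n) A) i j) ∧ M = L * U := by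
  induction n with
  | zero =>
    intro M _
    exact ⟨1, 1, fun i => i.elim0, fun i => i.elim0, fun i => i.elim0, fun i => i.elim0,
      fun i => i.elim0, by ext i; exact i.elim0⟩
  | succ n ih =>
    intro M hM
    have h00 := hM 0 0
    simp only [Matrix.one_apply_eq] at h00
    obtain ⟨a, ha⟩ := hq _ h00
    have hb : ∀ j : Fin n, q ∣ M 0 j.succ := fun j => by
      simpa [Matrix.one_apply, (Fin.succ_ne_zero j).symm] using hM 0 j.succ
    have hc : ∀ j : Fin n, q ∣ M j.succ 0 := fun j => by
      simpa [Matrix.one_apply, (Fin.succ_ne_zero j)] using hM j.succ 0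
    obtain ⟨L, U, h1, h2, h3, h4, h5, h6⟩ := ih
      (Matrix.of fun i j => M i.succ j.succ - M i.succ 0 * (↑a⁻¹ : A) * M 0 j.succ) (by
        intro i j
        have := hM i.succ j.succ
        simp only [Matrix.one_apply, Fin.succ_inj] at this
        simp only [Matrix.one_apply, Matrix.of_apply]
        rw [sub_right_comm]
        exact dvd_sub this ((hb j).mul_left _))
    refine ⟨Matrix.of (Fin.cons (Fin.cons 1 fun _ => 0)
        fun i => Fin.cons (M i.succ 0 * (↑a⁻¹ : A)) (L i)),
      Matrix.of (Fin.cons (M 0) fun i => Fin.cons 0 (U i)), ?_, ?_, ?_, ?_, ?_, ?_⟩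
    · intro i j
      refine Fin.cases ?_ (fun i => ?_) i <;> refine Fin.cases ?_ (fun j => ?_) j <;> simp
      exact h1 i j
    · intro i
      refine Fin.cases ?_ (fun i => ?_) i <;> simp [h2]
    · intro i j
      refine Fin.cases ?_ (fun i => ?_) i <;> refine Fin.cases ?_ (fun j => ?_) j
      · simp
      · simp [Matrix.one_apply, (Fin.succ_ne_zero j).symm]
      · simpa [Matrix.one_apply] using hc i
      · simpa [Matrix.one_apply] using h3 i j
    · intro i j
      refine Fin.cases ?_ (fun i => ?_) i <;> refine Fin.cases ?_ (fun j => ?_) j <;> simp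
      exact h4 i j
    · intro i j
      refine Fin.cases ?_ (fun i => ?_) i <;> refine Fin.cases ?_ (fun j => ?_) j
      · simpa using h00
      · simpa using hM 0 j.succ
      · simp [Matrix.one_apply]
      · simpa [Matrix.one_apply] using h5 i j
    · ext i j
      rw [Matrix.mul_apply, Fin.sum_univ_succ]
      refine Fin.cases ?_ (fun i => ?_) i
      · simp
      · refine Fin.cases ?_ (fun j => ?_) j
        · simp [← ha]
        · have := congrFun (congrFun h6 i) j
          rw [Matrix.mul_apply, Matrix.of_apply] at this
          simp [← this]

/-- Let `ξ = w_d` be the `d × d` antidiagonal matrix over `ℤ_p`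
(1-based: `ξ_{i,j} = 1` iff `i + j = d + 1`, i.e. 0-based `i + j + 1 = d`) and let
`Y` have all entries in `p^r·ℤ_p`.  Then `ξ + Y = R · ξ · S` with `R` upper
triangular unipotent, `R ≡ 1 mod p^r`, and `S` upper triangular, `S ≡ 1 mod p^r`. -/
theorem stmt1 (p : ℕ) [Fact p.Prime] (d r : ℕ) (hd : 1 ≤ d) (hr : 1 ≤ r)
    (ξ Y : Matrix (Fin d) (Fin d) ℤ_[p])
    (hξ : ∀ i j : Fin d, ξ i j = if (i : ℕ) + (j : ℕ) + 1 = d then 1 else 0)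
    (hY : ∀ i j : Fin d, (p : ℤ_[p]) ^ r ∣ Y i j) :
    ∃ R S : GL (Fin d) ℤ_[p],
      (∀ i j : Fin d, j < i → (R : Matrix (Fin d) (Fin d) ℤ_[p]) i j = 0) ∧
      (∀ i : Fin d, (R : Matrix (Fin d) (Fin d) ℤ_[p]) i i = 1) ∧
      (∀ i j : Fin d, (p : ℤ_[p]) ^ r ∣
        ((R : Matrix (Fin d) (Fin d) ℤ_[p]) i j - (1 : Matrix (Fin d) (Fin d) ℤ_[p]) i j)) ∧
      (∀ i j : Fin d, j < i → (S : Matrix (Fin d) (Fin d) ℤ_[p]) i j = 0) ∧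
      (∀ i j : Fin d, (p : ℤ_[p]) ^ r ∣
        ((S : Matrix (Fin d) (Fin d) ℤ_[p]) i j - (1 : Matrix (Fin d) (Fin d) ℤ_[p]) i j)) ∧
      ξ + Y = (R : Matrix (Fin d) (Fin d) ℤ_[p]) * ξ * (S : Matrix (Fin d) (Fin d) ℤ_[p]) := by
  classical
  have hq : ∀ x : ℤ_[p], (p : ℤ_[p]) ^ r ∣ x - 1 → IsUnit x := by
    intro x hx
    by_contra h
    have h1 : (p : ℤ_[p]) ∣ x := by
      rw [← PadicInt.norm_lt_one_iff_dvd]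
      exact PadicInt.mem_nonunits.1 h
    have h2 : (p : ℤ_[p]) ∣ 1 := by
      have := dvd_sub h1 ((dvd_pow_self _ (by omega)).trans hx)
      simpa using this
    exact PadicInt.prime_p.not_isUnit (isUnit_of_dvd_one h2)
  have hx1 : ξ = (1 : Matrix (Fin d) (Fin d) ℤ_[p]).submatrix Fin.revPerm id := by
    ext i j
    rw [hξ, Matrix.submatrix_apply, Matrix.one_apply]
    congr 1
    simp only [Fin.revPerm_apply, id, Fin.ext_iff, Fin.val_rev, eq_iff_iff]
    omega
  obtain ⟨L, U, h1, h2, h3, h4, h5, h6⟩ := aux_lu ((p : ℤ_[p]) ^ r) hq d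
    ((ξ + Y).submatrix Fin.revPerm id) (by
      intro i j
      simpa [hx1, Matrix.one_apply] using hY i.rev j)
  have hdiv : ∀ i j, (p : ℤ_[p]) ^ r ∣ (L.submatrix Fin.revPerm Fin.revPerm) i j
      - (1 : Matrix (Fin d) (Fin d) ℤ_[p]) i j := by
    intro i j
    have := h3 i.rev j.rev
    simpa [Matrix.one_apply] using this
  have hL : IsUnit (L.submatrix Fin.revPerm Fin.revPerm) := by
    rw [Matrix.isUnit_iff_isUnit_det, Matrix.det_submatrix_equiv_self,
      Matrix.det_of_isLowerTriangular L (fun i j h => h1 i j (by simpa using h))]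
    simp [h2]
  have hU : IsUnit U := by
    rw [Matrix.isUnit_iff_isUnit_det,
      Matrix.det_of_isUpperTriangular (M := U) (fun i j h => h4 i j (by simpa using h))]
    rw [IsUnit.prod_univ_iff]
    intro i
    exact hq _ (by simpa using h5 i i)
  obtain ⟨R, hR⟩ := hL
  obtain ⟨S, hS⟩ := hU
  refine ⟨R, S, ?_, ?_, ?_, ?_, ?_, ?_⟩
  · intro i j h
    rw [hR]
    exact h1 _ _ (by simpa using h)
  · intro i
    rw [hR]
    exact h2 _
  · rw [hR]
    exact hdiv
  · rw [hS]
    exact h4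
  · rw [hS]
    exact h5
  · rw [hR, hS]
    have e : L.submatrix Fin.revPerm Fin.revPerm * ξ = L.submatrix Fin.revPerm id := by
      rw [hx1, Matrix.submatrix_mul_equiv, mul_one]
    rw [e]
    have := congrArg (fun X => Matrix.submatrix X Fin.revPerm id) h6
    simp only [Matrix.submatrix_submatrix] at this
    ext i j
    have t := congrFun (congrFun this i) j
    simp only [Matrix.submatrix_apply, Matrix.mul_apply, Function.comp, id, Fin.revPerm_apply, Fin.rev_rev] at t ⊢
    exact t
end

section
/- Let p be a prime and let n ≥ 1 and r ≥ 1 be integers. Let ξ be the n×(n−1) matrix over ℤ_p whose first row is zero and whose bottom (n−1)×(n−1) block is the antidiagonal matrix w_{n−1}, and let Y be an n×(n−1) matrix over ℤ_p all of whose entries lie in p^r·ℤ_p. Then there exist R ∈ GL_n(ℤ_p) upper triangular unipotent with R ≡ 1 mod p^r and S ∈ GL_{n−1}(ℤ_p) upper triangular with S ≡ 1 mod p^r such that ξ + Y = R·ξ·S. -/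
theorem aux_unit (p : ℕ) [Fact p.Prime] (r : ℕ) (hr : 1 ≤ r) (a : ℤ_[p])
    (h : (p : ℤ_[p]) ^ r ∣ a - 1) : IsUnit a := by
  by_contra hu
  have h1 : (p : ℤ_[p]) ∣ a - 1 := (dvd_pow_self _ (by omega)).trans h
  have h2 : (a - 1) ∈ nonunits ℤ_[p] := fun hh => PadicInt.p_nonunit (isUnit_of_dvd_unit h1 hh)
  have h3 : (1 - a) ∈ nonunits ℤ_[p] := by
    intro hh
    apply h2
    have := hh.neg
    rwa [neg_sub] at this
  have := IsLocalRing.nonunits_add hu h3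
  apply this
  simp

theorem aux_LU (p : ℕ) [Fact p.Prime] (r : ℕ) (hr : 1 ≤ r) (m : ℕ) :
    ∀ A : Matrix (Fin m) (Fin m) ℤ_[p],
    (∀ i j, (p : ℤ_[p]) ^ r ∣ A i j - (1 : Matrix (Fin m) (Fin m) ℤ_[p]) i j) →
    ∃ L U : Matrix (Fin m) (Fin m) ℤ_[p],
      (∀ i j, i < j → L i j = 0) ∧ (∀ i, L i i = 1) ∧
      (∀ i j, (p : ℤ_[p]) ^ r ∣ L i j - (1 : Matrix (Fin m) (Fin m) ℤ_[p]) i j) ∧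
      (∀ i j, j < i → U i j = 0) ∧
      (∀ i j, (p : ℤ_[p]) ^ r ∣ U i j - (1 : Matrix (Fin m) (Fin m) ℤ_[p]) i j) ∧
      A = L * U := by
  induction m with
  | zero =>
    intro A _
    exact ⟨1, 1, fun i => i.elim0, fun i => i.elim0, fun i => i.elim0, fun i => i.elim0,
      fun i => i.elim0, by ext i; exact i.elim0⟩
  | succ m ih =>
    intro A hA
    have hu : IsUnit (A 0 0) := aux_unit p r hr _ (by simpa using hA 0 0)
    obtain ⟨b, hb⟩ := hu.exists_left_inv
    have hrow : ∀ j : Fin m, (p : ℤ_[p]) ^ r ∣ A 0 j.succ := fun j => by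
      simpa [Matrix.one_apply, (Fin.succ_ne_zero j).symm] using hA 0 j.succ
    have hcol : ∀ j : Fin m, (p : ℤ_[p]) ^ r ∣ A j.succ 0 := fun j => by
      simpa [Matrix.one_apply] using hA j.succ 0
    obtain ⟨L, U, h1, h2, h3, h4, h5, h6⟩ := ih
      (Matrix.of fun i j => A i.succ j.succ - A i.succ 0 * b * A 0 j.succ) (by
        intro i j
        have h := dvd_sub (hA i.succ j.succ) ((hrow j).mul_left (A i.succ 0 * b))
        simp only [Matrix.of_apply, Matrix.one_apply, Fin.succ_inj] at h ⊢
        convert h using 1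
        ring)
    refine ⟨Matrix.of (Fin.cons (Fin.cons 1 0) fun i => Fin.cons (A i.succ 0 * b) (L i)),
      Matrix.of (Fin.cons (A 0) fun i => Fin.cons 0 (U i)), ?_, ?_, ?_, ?_, ?_, ?_⟩
    · intro i j
      refine Fin.cases ?_ (fun i => ?_) i <;> refine Fin.cases ?_ (fun j => ?_) j <;> simp
      exact h1 i j
    · intro i
      refine Fin.cases ?_ (fun i => ?_) i <;> simp [h2]
    · intro i j
      refine Fin.cases ?_ (fun i => ?_) i <;> refine Fin.cases ?_ (fun j => ?_) j <;>
        simp [Matrix.one_apply, (Fin.succ_ne_zero _).symm]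
      · exact (hcol i).mul_right b
      · simpa [Matrix.one_apply] using h3 i j
    · intro i j
      refine Fin.cases ?_ (fun i => ?_) i <;> refine Fin.cases ?_ (fun j => ?_) j <;> simp
      exact h4 i j
    · intro i j
      refine Fin.cases ?_ (fun i => ?_) i
      · exact hA 0 j
      · refine Fin.cases ?_ (fun j => ?_) j
        · simp [Matrix.one_apply]
        · simpa [Matrix.one_apply] using h5 i j
    · ext i j
      rw [Matrix.mul_apply, Fin.sum_univ_succ]
      refine Fin.cases ?_ (fun i => ?_) i
      · simp
      · refine Fin.cases ?_ (fun j => ?_) j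
        · simp [mul_assoc, hb]
        · have := congrFun (congrFun h6 i) j
          rw [Matrix.mul_apply] at this
          simp only [Matrix.of_apply, Fin.cons_succ, Fin.cons_zero] at this ⊢
          rw [← this]
          ring

theorem aux_main (p : ℕ) [Fact p.Prime] (m r : ℕ) (hr : 1 ≤ r)
    (ξ Y : Matrix (Fin (m + 1)) (Fin m) ℤ_[p])
    (hξ : ∀ (i : Fin (m + 1)) (j : Fin m), ξ i j = if (i : ℕ) + (j : ℕ) + 1 = m + 1 then 1 else 0)
    (hY : ∀ (i : Fin (m + 1)) (j : Fin m), (p : ℤ_[p]) ^ r ∣ Y i j) :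
    ∃ (R : GL (Fin (m + 1)) ℤ_[p]) (S : GL (Fin m) ℤ_[p]),
      (∀ i j : Fin (m + 1), j < i → (R : Matrix (Fin (m + 1)) (Fin (m + 1)) ℤ_[p]) i j = 0) ∧
      (∀ i : Fin (m + 1), (R : Matrix (Fin (m + 1)) (Fin (m + 1)) ℤ_[p]) i i = 1) ∧
      (∀ i j : Fin (m + 1), (p : ℤ_[p]) ^ r ∣
        ((R : Matrix (Fin (m + 1)) (Fin (m + 1)) ℤ_[p]) i j
          - (1 : Matrix (Fin (m + 1)) (Fin (m + 1)) ℤ_[p]) i j)) ∧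
      (∀ i j : Fin m, j < i → (S : Matrix (Fin m) (Fin m) ℤ_[p]) i j = 0) ∧
      (∀ i j : Fin m, (p : ℤ_[p]) ^ r ∣
        ((S : Matrix (Fin m) (Fin m) ℤ_[p]) i j - (1 : Matrix (Fin m) (Fin m) ℤ_[p]) i j)) ∧
      ξ + Y = (R : Matrix (Fin (m + 1)) (Fin (m + 1)) ℤ_[p]) * ξ
          * (S : Matrix (Fin m) (Fin m) ℤ_[p]) := by
  have hξ0 : ∀ j, ξ 0 j = 0 := fun j => by
    rw [hξ, if_neg]; have := j.2; simp; omega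
  have hξs : ∀ (i j : Fin m), ξ i.succ j = if i = j.rev then 1 else 0 := fun i j => by
    rw [hξ]
    have := j.2
    have := i.2
    simp only [Fin.ext_iff, Fin.val_succ, Fin.val_rev]
    congr 1
    apply propext
    omega
  obtain ⟨L, U, h1, h2, h3, h4, h5, h6⟩ := aux_LU p r hr m
    (Matrix.of fun i j => (ξ + Y) i.rev.succ j) (by
      intro i j
      simp only [Matrix.of_apply, Matrix.add_apply, hξs, Fin.rev_inj, Matrix.one_apply]
      simpa using hY i.rev.succ j)
  have hUdet : IsUnit U.det := by
    rw [Matrix.det_of_upperTriangular (fun i j h => h4 i j h)]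
    rw [IsUnit.prod_univ_iff]
    intro i
    exact aux_unit p r hr _ (by simpa using h5 i i)
  have hUinv : U⁻¹ * U = 1 := Matrix.nonsing_inv_mul U hUdet
  let y : Fin m → ℤ_[p] := fun j => Y 0 j
  let v : Fin m → ℤ_[p] := Matrix.vecMul y U⁻¹
  have hv : ∀ k, (p : ℤ_[p]) ^ r ∣ v k := fun k => by
    simp only [v, Matrix.vecMul, dotProduct, y]
    exact Finset.dvd_sum fun i _ => (hY 0 i).mul_right _
  have hvU : Matrix.vecMul v U = y := by
    simp only [v, Matrix.vecMul_vecMul, hUinv, Matrix.vecMul_one]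
  let R : Matrix (Fin (m + 1)) (Fin (m + 1)) ℤ_[p] :=
    Matrix.of (Fin.cons (Fin.cons 1 fun j => v j.rev)
      fun i => Fin.cons 0 fun j => L i.rev j.rev)
  have r1 : ∀ i j, j < i → R i j = 0 := by
    intro i j
    refine Fin.cases ?_ (fun i => ?_) i <;> refine Fin.cases ?_ (fun j => ?_) j <;> simp [R]
    intro h
    exact h1 _ _ (Fin.rev_lt_rev.2 h)
  have r2 : ∀ i, R i i = 1 := by
    intro i
    refine Fin.cases ?_ (fun i => ?_) i <;> simp [R, h2]
  have hRdet : IsUnit R.det := by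
    rw [Matrix.det_of_upperTriangular (fun i j h => r1 i j h)]
    simp [r2]
  refine ⟨Matrix.GeneralLinearGroup.mk'' R hRdet, Matrix.GeneralLinearGroup.mk'' U hUdet,
    r1, r2, ?_, h4, h5, ?_⟩
  · intro i j
    change _ ∣ R i j - _
    refine Fin.cases ?_ (fun i => ?_) i <;> refine Fin.cases ?_ (fun j => ?_) j <;>
      simp [R, Matrix.one_apply, (Fin.succ_ne_zero _).symm, hv]
    simpa [Matrix.one_apply] using h3 i.rev j.rev
  · change ξ + Y = R * ξ * U
    have hR : ∀ i j, (R * ξ) i j = R i j.rev.succ := by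
      intro i j
      rw [Matrix.mul_apply, Fin.sum_univ_succ]
      simp [hξ0, hξs]
    ext i j
    rw [Matrix.mul_apply]
    simp only [hR]
    refine Fin.cases ?_ (fun i => ?_) i
    · have := congrFun hvU j
      simp only [Matrix.vecMul, dotProduct] at this
      simp [R, hξ0, this, y]
    · have := congrFun (congrFun h6 i.rev) j
      rw [Matrix.mul_apply] at this
      simp only [Matrix.of_apply, Fin.rev_rev] at this
      simp [R, this]


/-- Let `ξ` be the `n × (n−1)` matrix over `ℤ_p` whose first row
is zero and whose bottom `(n−1) × (n−1)` block is the antidiagonal `w_{n−1}`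
(1-based: `ξ_{i,j} = 1` iff `i + j = n + 1`, i.e. 0-based `i + j + 1 = n`), and let
`Y` be an `n × (n−1)` matrix all of whose entries lie in `p^r·ℤ_p`.  Then
`ξ + Y = R · ξ · S` with `R ∈ GL_n(ℤ_p)` upper triangular unipotent, `R ≡ 1 mod p^r`,
and `S ∈ GL_{n−1}(ℤ_p)` upper triangular, `S ≡ 1 mod p^r`. -/
theorem stmt2 (p : ℕ) [Fact p.Prime] (n r : ℕ) (hn : 1 ≤ n) (hr : 1 ≤ r)
    (ξ Y : Matrix (Fin n) (Fin (n - 1)) ℤ_[p])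
    (hξ : ∀ (i : Fin n) (j : Fin (n - 1)), ξ i j = if (i : ℕ) + (j : ℕ) + 1 = n then 1 else 0)
    (hY : ∀ (i : Fin n) (j : Fin (n - 1)), (p : ℤ_[p]) ^ r ∣ Y i j) :
    ∃ (R : GL (Fin n) ℤ_[p]) (S : GL (Fin (n - 1)) ℤ_[p]),
      (∀ i j : Fin n, j < i → (R : Matrix (Fin n) (Fin n) ℤ_[p]) i j = 0) ∧
      (∀ i : Fin n, (R : Matrix (Fin n) (Fin n) ℤ_[p]) i i = 1) ∧
      (∀ i j : Fin n, (p : ℤ_[p]) ^ r ∣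
        ((R : Matrix (Fin n) (Fin n) ℤ_[p]) i j - (1 : Matrix (Fin n) (Fin n) ℤ_[p]) i j)) ∧
      (∀ i j : Fin (n - 1), j < i → (S : Matrix (Fin (n - 1)) (Fin (n - 1)) ℤ_[p]) i j = 0) ∧
      (∀ i j : Fin (n - 1), (p : ℤ_[p]) ^ r ∣
        ((S : Matrix (Fin (n - 1)) (Fin (n - 1)) ℤ_[p]) i j
          - (1 : Matrix (Fin (n - 1)) (Fin (n - 1)) ℤ_[p]) i j)) ∧
      ξ + Y = (R : Matrix (Fin n) (Fin n) ℤ_[p]) * ξ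
          * (S : Matrix (Fin (n - 1)) (Fin (n - 1)) ℤ_[p]) := by
  obtain ⟨m, rfl⟩ : ∃ m, n = m + 1 := ⟨n - 1, by omega⟩
  exact aux_main p m r hr ξ Y hξ hY
end

section
/- Let p be a prime and let m ≥ 1 and r ≥ 1 be integers. The set of all products g₁·b with g₁ ∈ GL_m(ℤ_p) satisfying g₁ ≡ 1 mod p^r and b ∈ GL_m(ℤ_p) upper triangular is a subgroup of GL_m(ℤ_p), and it is equal to the depth-r Iwahori subgroup {g ∈ GL_m(ℤ_p) : g is upper triangular mod p^r}. -/
/-- The set of products `g₁ · b` with `g₁ ≡ 1 mod p^r` and `b`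
upper triangular (both in `GL_m(ℤ_p)`) is a subgroup of `GL_m(ℤ_p)`, equal to the
depth-`r` Iwahori subgroup of matrices that are upper triangular mod `p^r`. -/
theorem stmt3 (p : ℕ) [Fact p.Prime] (m r : ℕ) (hm : 1 ≤ m) (hr : 1 ≤ r) :
    (∃ H : Subgroup (GL (Fin m) ℤ_[p]),
      (H : Set (GL (Fin m) ℤ_[p])) =
        {g : GL (Fin m) ℤ_[p] | ∃ g₁ b : GL (Fin m) ℤ_[p],
          (∀ i j : Fin m, (p : ℤ_[p]) ^ r ∣
            ((g₁ : Matrix (Fin m) (Fin m) ℤ_[p]) i j - (1 : Matrix (Fin m) (Fin m) ℤ_[p]) i j)) ∧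
          (∀ i j : Fin m, j < i → (b : Matrix (Fin m) (Fin m) ℤ_[p]) i j = 0) ∧
          g = g₁ * b}) ∧
    ({g : GL (Fin m) ℤ_[p] | ∃ g₁ b : GL (Fin m) ℤ_[p],
        (∀ i j : Fin m, (p : ℤ_[p]) ^ r ∣
          ((g₁ : Matrix (Fin m) (Fin m) ℤ_[p]) i j - (1 : Matrix (Fin m) (Fin m) ℤ_[p]) i j)) ∧
        (∀ i j : Fin m, j < i → (b : Matrix (Fin m) (Fin m) ℤ_[p]) i j = 0) ∧
        g = g₁ * b} =
      {g : GL (Fin m) ℤ_[p] | ∀ i j : Fin m, j < i →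
        (p : ℤ_[p]) ^ r ∣ (g : Matrix (Fin m) (Fin m) ℤ_[p]) i j}) := by
  set I : Ideal ℤ_[p] := Ideal.span {(p : ℤ_[p]) ^ r} with hI
  let f : ℤ_[p] →+* ℤ_[p] ⧸ I := Ideal.Quotient.mk I
  have hf0 : ∀ x, f x = 0 ↔ (p : ℤ_[p]) ^ r ∣ x := fun x => by
    rw [Ideal.Quotient.eq_zero_iff_mem, hI, Ideal.mem_span_singleton]
  let F : GL (Fin m) ℤ_[p] →* GL (Fin m) (ℤ_[p] ⧸ I) := Matrix.GeneralLinearGroup.map f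
  have hF : ∀ (g : GL (Fin m) ℤ_[p]) (i j : Fin m), (F g : Matrix (Fin m) (Fin m) (ℤ_[p] ⧸ I)) i j =
      f ((g : Matrix (Fin m) (Fin m) ℤ_[p]) i j) := fun g i j => rfl
  have hker : ∀ g : GL (Fin m) ℤ_[p], (∀ i j : Fin m, (p : ℤ_[p]) ^ r ∣
      ((g : Matrix (Fin m) (Fin m) ℤ_[p]) i j - (1 : Matrix (Fin m) (Fin m) ℤ_[p]) i j)) ↔
      F g = 1 := by
    intro g
    rw [Units.ext_iff, ← Matrix.ext_iff]
    refine forall_congr' fun i => forall_congr' fun j => ?_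
    rw [← hf0, map_sub, sub_eq_zero, hF]
    simp [Matrix.one_apply, apply_ite f]
  have hIw : ∀ g : GL (Fin m) ℤ_[p], (∀ i j : Fin m, j < i →
      (p : ℤ_[p]) ^ r ∣ (g : Matrix (Fin m) (Fin m) ℤ_[p]) i j) ↔
      (F g : Matrix (Fin m) (Fin m) (ℤ_[p] ⧸ I)).BlockTriangular id := by
    intro g
    refine forall_congr' fun i => forall_congr' fun j => ?_
    rw [hF, hf0]; rfl
  have key : ({g : GL (Fin m) ℤ_[p] | ∃ g₁ b : GL (Fin m) ℤ_[p],
        (∀ i j : Fin m, (p : ℤ_[p]) ^ r ∣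
          ((g₁ : Matrix (Fin m) (Fin m) ℤ_[p]) i j - (1 : Matrix (Fin m) (Fin m) ℤ_[p]) i j)) ∧
        (∀ i j : Fin m, j < i → (b : Matrix (Fin m) (Fin m) ℤ_[p]) i j = 0) ∧
        g = g₁ * b} =
      {g : GL (Fin m) ℤ_[p] | ∀ i j : Fin m, j < i →
        (p : ℤ_[p]) ^ r ∣ (g : Matrix (Fin m) (Fin m) ℤ_[p]) i j}) := by
    ext g
    simp only [Set.mem_ofPred_eq]
    constructor
    · rintro ⟨g₁, b, h1, hb, rfl⟩
      rw [hker] at h1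
      rw [hIw, map_mul, h1, one_mul, ← hIw]
      intro i j hij
      rw [hb i j hij]
      exact dvd_zero _
    · intro hg
      let B : Matrix (Fin m) (Fin m) ℤ_[p] :=
        Matrix.of fun i j => if j < i then 0 else (g : Matrix (Fin m) (Fin m) ℤ_[p]) i j
      have hB : f.mapMatrix B = f.mapMatrix (g : Matrix (Fin m) (Fin m) ℤ_[p]) := by
        ext i j
        simp only [RingHom.mapMatrix_apply, Matrix.map_apply, B, Matrix.of_apply]
        split_ifs with h
        · rw [map_zero, (hf0 _).2 (hg i j h)]
        · rfl
      have hdet : f (B.det - (g : Matrix (Fin m) (Fin m) ℤ_[p]).det) = 0 := by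
        rw [map_sub, RingHom.map_det, RingHom.map_det, hB, sub_self]
      rw [hf0] at hdet
      have hgu : IsUnit (g : Matrix (Fin m) (Fin m) ℤ_[p]).det :=
        (Matrix.isUnit_iff_isUnit_det _).1 g.isUnit
      have hBu : IsUnit B.det := by
        by_contra h
        have h1 : B.det ∈ IsLocalRing.maximalIdeal ℤ_[p] := h
        have h2 : B.det - (g : Matrix (Fin m) (Fin m) ℤ_[p]).det ∈ IsLocalRing.maximalIdeal ℤ_[p] := by
          refine Ideal.mem_of_dvd _ ((dvd_pow_self _ (by omega)).trans hdet) ?_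
          rw [PadicInt.maximalIdeal_eq_span_p]
          exact Ideal.mem_span_singleton_self _
        have h3 := Ideal.sub_mem _ h1 h2
        rw [sub_sub_cancel] at h3
        exact h3 hgu
      let b : GL (Fin m) ℤ_[p] := Matrix.GeneralLinearGroup.mk'' B hBu
      have hFb : F b = F g := Units.ext hB
      refine ⟨g * b⁻¹, b, ?_, ?_, by simp⟩
      · rw [hker, map_mul, map_inv, hFb, mul_inv_cancel]
      · intro i j hij
        change B i j = 0
        simp [B, hij]
  refine ⟨?_, key⟩
  rw [key]
  refine ⟨{ carrier := {g : GL (Fin m) ℤ_[p] | ∀ i j : Fin m, j < i →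
        (p : ℤ_[p]) ^ r ∣ (g : Matrix (Fin m) (Fin m) ℤ_[p]) i j}, mul_mem' := ?_, one_mem' := ?_, inv_mem' := ?_ }, rfl⟩
  · intro a b ha hb
    simp only [Set.mem_ofPred_eq] at *
    rw [hIw] at *
    rw [map_mul]
    exact ha.mul hb
  · simp only [Set.mem_ofPred_eq]
    rw [hIw, map_one]
    exact Matrix.blockTriangular_one
  · intro a ha
    simp only [Set.mem_ofPred_eq] at *
    rw [hIw] at *
    rw [map_inv, Matrix.coe_units_inv]
    haveI := (F a).invertible
    exact Matrix.blockTriangular_inv_of_blockTriangular ha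
end

section
/- Let p be a prime and let n ≥ 1 and r ≥ 1 be integers. For g ∈ GL_{2n−1}(ℤ_p) the following are equivalent: (i) g is upper triangular mod p^r; (ii) there exist h₁ ∈ GL_{n−1}(ℤ_p), h₂ ∈ GL_n(ℤ_p), units y_1, …, y_{2n−1} ∈ ℤ_p^× satisfying y_i = y_{2n−i} for all 1 ≤ i ≤ 2n−1, and an upper triangular b ∈ GL_{2n−1}(ℤ_p), such that diag(h₁,h₂) ≡ diag(y_1, …, y_{2n−1}) mod p^r and g = u^{-1}·diag(h₁,h₂)·u·b. -/
/- We index `GL_{2n−1}` by `Fin (n-1) ⊕ Fin n` (top-left block of size `n−1`,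
bottom-right block of size `n`), with the order embedding `eF` into `Fin (2n−1)`
giving the usual linear ordering of the `2n−1` coordinates. -/

/-- The canonical order-embedding `Fin (n-1) ⊕ Fin n → Fin (2n-1)`. -/
def eF (n : ℕ) : Fin (n - 1) ⊕ Fin n → Fin (2 * n - 1) :=
  Sum.elim (fun a => ⟨(a : ℕ), by have := a.isLt; omega⟩)
    (fun a => ⟨n - 1 + (a : ℕ), by have := a.isLt; omega⟩)

/-- The `n × (n−1)` matrix `ξ`: first row zero, bottom `(n−1) × (n−1)` block the
antidiagonal matrix `w_{n−1}` (0-based: `ξ i j = 1` iff `i + j + 1 = n`). -/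
noncomputable def xiMat (p n : ℕ) [Fact p.Prime] : Matrix (Fin n) (Fin (n - 1)) ℤ_[p] :=
  fun i j => if (i : ℕ) + (j : ℕ) + 1 = n then 1 else 0

/-- The element `u ∈ GL_{2n−1}(ℤ_p)`: identity diagonal blocks, lower-left block
`ξ`, zero upper-right block. -/
noncomputable def uMat (p n : ℕ) [Fact p.Prime] :
    Matrix (Fin (n - 1) ⊕ Fin n) (Fin (n - 1) ⊕ Fin n) ℤ_[p] :=
  Matrix.fromBlocks 1 0 (xiMat p n) 1

/-- The block diagonal matrix `diag(h₁, h₂)`. -/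
noncomputable def blockDiag (p n : ℕ) [Fact p.Prime] (h₁ : Matrix (Fin (n - 1)) (Fin (n - 1)) ℤ_[p])
    (h₂ : Matrix (Fin n) (Fin n) ℤ_[p]) :
    Matrix (Fin (n - 1) ⊕ Fin n) (Fin (n - 1) ⊕ Fin n) ℤ_[p] :=
  Matrix.fromBlocks h₁ 0 0 h₂

theorem lu_aux {R S : Type*} [CommRing R] [CommRing S] (π : R →+* S) [IsLocalHom π] :
    ∀ (m : ℕ) (A : Matrix (Fin m) (Fin m) R), (∀ i j, j < i → π (A i j) = 0) →
      (∀ i, IsUnit (A i i)) →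
      ∃ L U : Matrix (Fin m) (Fin m) R, A = L * U ∧ (∀ i j, i < j → L i j = 0) ∧
        L.map π = 1 ∧ (∀ i j, j < i → U i j = 0) := by
  intro m
  induction m with
  | zero =>
    intro A _ _
    exact ⟨1, A, by simp, fun i => i.elim0, by ext i; exact i.elim0, fun i => i.elim0⟩
  | succ m ih =>
    intro A hA hd
    obtain ⟨a, ha⟩ := hd 0
    let D : Matrix (Fin m) (Fin m) R := fun i j =>
      A i.succ j.succ - A i.succ 0 * (↑a⁻¹ : R) * A 0 j.succ
    have hc : ∀ i : Fin m, π (A i.succ 0) = 0 := fun i => hA _ _ (Fin.succ_pos i)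
    have hD : ∀ i j, π (D i j) = π (A i.succ j.succ) := by
      intro i j; simp [D, hc]
    obtain ⟨L, U, h1, h2, h3, h4⟩ := ih D
      (fun i j hij => by rw [hD]; exact hA _ _ (Fin.succ_lt_succ_iff.2 hij))
      (fun i => by
        apply isUnit_of_map_unit π
        rw [hD]
        exact (hd i.succ).map π)
    let L' : Matrix (Fin (m+1)) (Fin (m+1)) R := fun i =>
      Fin.cases (fun j => Fin.cases 1 (fun _ => 0) j)
        (fun i j => Fin.cases (A i.succ 0 * (↑a⁻¹ : R)) (fun j => L i j) j) i
    let U' : Matrix (Fin (m+1)) (Fin (m+1)) R := fun i =>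
      Fin.cases (fun j => A 0 j)
        (fun i j => Fin.cases 0 (fun j => U i j) j) i
    refine ⟨L', U', ?_, ?_, ?_, ?_⟩
    · ext i j
      rw [Matrix.mul_apply, Fin.sum_univ_succ]
      refine Fin.cases ?_ (fun i => ?_) i
      · simp [L', U']
      · refine Fin.cases ?_ (fun j => ?_) j
        · simp [L', U', ← ha]
        · have := congrFun (congrFun h1 i) j
          rw [Matrix.mul_apply] at this
          simp only [L', U', Fin.cases_zero, Fin.cases_succ]
          rw [← this]
          simp [D]
    · intro i j
      refine Fin.cases ?_ (fun i => ?_) i <;> refine Fin.cases ?_ (fun j => ?_) j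
      · simp
      · simp [L']
      · simp
      · intro h; exact h2 i j (Fin.succ_lt_succ_iff.1 h)
    · ext i j
      rw [Matrix.map_apply]
      refine Fin.cases ?_ (fun i => ?_) i <;> refine Fin.cases ?_ (fun j => ?_) j
      · simp [L']
      · simp [L', (Fin.succ_ne_zero _).symm]
      · simp [L', hc]
      · have := congrFun (congrFun h3 i) j
        simpa [L', Matrix.one_apply] using this
    · intro i j
      refine Fin.cases ?_ (fun i => ?_) i <;> refine Fin.cases ?_ (fun j => ?_) j
      · simp
      · simp
      · simp [U']
      · intro h; exact h4 i j (Fin.succ_lt_succ_iff.1 h)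

theorem ul_aux {R S : Type*} [CommRing R] [CommRing S] (π : R →+* S) [IsLocalHom π]
    (m : ℕ) (A : Matrix (Fin m) (Fin m) R) (hA : A.map π = 1) :
      ∃ K M : Matrix (Fin m) (Fin m) R, A = K * M ∧ (∀ i j, j < i → K i j = 0) ∧
        K.map π = 1 ∧ M.map π = 1 ∧ (∀ i j, i < j → M i j = 0) := by
  have hA' : ∀ i j, π (A i j) = (1 : Matrix (Fin m) (Fin m) S) i j := fun i j =>
    congrFun (congrFun hA i) j
  obtain ⟨L, U, h1, h2, h3, h4⟩ := lu_aux π m (A.submatrix Fin.rev Fin.rev)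
    (fun i j hij => by
      rw [Matrix.submatrix_apply, hA', Matrix.one_apply_ne]
      exact fun h => hij.ne' (Fin.rev_injective h))
    (fun i => by
      apply isUnit_of_map_unit π
      rw [Matrix.submatrix_apply, hA', Matrix.one_apply_eq]
      exact isUnit_one)
  have hAe : A = L.submatrix Fin.rev Fin.rev * U.submatrix Fin.rev Fin.rev := by
    have : (A.submatrix Fin.rev Fin.rev).submatrix Fin.rev Fin.rev = A := by
      ext i j; simp
    rw [← this, h1]
    exact (Matrix.submatrix_mul_equiv L U Fin.rev Fin.revPerm Fin.rev).symm
  have hK : (L.submatrix Fin.rev Fin.rev).map π = 1 := by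
    rw [← Matrix.submatrix_map, h3]
    exact Matrix.submatrix_one _ Fin.rev_injective
  refine ⟨_, _, hAe, ?_, hK, ?_, ?_⟩
  · intro i j h; exact h2 _ _ (Fin.rev_lt_rev.2 h)
  · have := congrArg (fun M => M.map π) hAe
    simp only [Matrix.map_mul, hK, hA, one_mul] at this
    exact this.symm
  · intro i j h; exact h4 _ _ (Fin.rev_lt_rev.2 h)

theorem det_unit_aux {R S : Type*} [CommRing R] [CommRing S] (π : R →+* S) [IsLocalHom π]
    {m : Type*} [Fintype m] [DecidableEq m] (A : Matrix m m R) (h : IsUnit (A.map π).det) :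
    IsUnit A.det := by
  apply isUnit_of_map_unit π
  rwa [RingHom.map_det]

theorem diag_unit_aux {R S : Type*} [CommRing R] [CommRing S] (π : R →+* S) [IsLocalHom π]
    {m : ℕ} (A : Matrix (Fin m) (Fin m) R) (h : IsUnit (A.map π).det)
    (hA : ∀ i j, j < i → π (A i j) = 0) (i : Fin m) : IsUnit (A i i) := by
  apply isUnit_of_map_unit π
  have hT : (A.map π).IsUpperTriangular := fun i j hij => hA i j hij
  rw [Matrix.det_of_isUpperTriangular hT] at h
  exact (IsUnit.prod_univ_iff.1 h) i

theorem core1 (p n : ℕ) [Fact p.Prime] {S : Type*} [CommRing S] (π : ℤ_[p] →+* S) [IsLocalHom π]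
    (ψ : Matrix (Fin n) (Fin (n - 1)) ℤ_[p]) (hψ : ψ.map π = (xiMat p n).map π) :
    ∃ (K : Matrix (Fin n) (Fin n) ℤ_[p]) (κ : Matrix (Fin (n - 1)) (Fin (n - 1)) ℤ_[p]),
      ψ = K * xiMat p n * κ ∧ (∀ i j, j < i → K i j = 0) ∧ (∀ i j, j < i → κ i j = 0) ∧
      K.map π = 1 ∧ κ.map π = 1 := by
  let Ψ : Matrix (Fin n) (Fin n) ℤ_[p] := fun i c =>
    if h : (c : ℕ) = 0 then (1 : Matrix (Fin n) (Fin n) ℤ_[p]) i c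
      else ψ i ⟨n - 1 - c, by have := c.isLt; omega⟩
  have hψ' : ∀ i j, π (ψ i j) = if (i : ℕ) + (j : ℕ) + 1 = n then 1 else 0 := by
    intro i j
    have := congrFun (congrFun hψ i) j
    simpa [xiMat, apply_ite π] using this
  have hΨ : Ψ.map π = 1 := by
    ext i c
    rw [Matrix.map_apply]
    by_cases h : (c : ℕ) = 0
    · simp [Ψ, h, Matrix.one_apply, apply_ite π]
    · simp only [Ψ, h, dite_false, hψ', Matrix.one_apply]
      congr 1
      have := c.isLt
      have := i.isLt
      simp only [Fin.ext_iff, eq_iff_iff]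
      omega
  obtain ⟨K, M, h1, h2, h3, h4, h5⟩ := ul_aux π n Ψ hΨ
  let f : Fin (n - 1) → Fin n := fun a => ⟨n - 1 - a, by have := a.isLt; omega⟩
  have hf : ∀ a, (f a : ℕ) = n - 1 - a := fun a => rfl
  refine ⟨K, M.submatrix f f, ?_, h2, ?_, h3, ?_⟩
  · ext i j
    have e1 : ψ i j = Ψ i (f j) := by
      have := j.isLt
      have h0 : ¬ ((f j : Fin n) : ℕ) = 0 := by rw [hf]; omega
      simp only [Ψ, h0, dite_false]
      congr 1
      ext
      simp only [hf]
      omega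
    rw [e1, h1, Matrix.mul_assoc, Matrix.mul_apply, Matrix.mul_apply]
    refine Finset.sum_congr rfl fun k _ => ?_
    congr 1
    rw [Matrix.mul_apply]
    have hj := j.isLt
    have hk := k.isLt
    by_cases h0 : (k : ℕ) = 0
    · rw [h5 k (f j) (by rw [Fin.lt_def, hf]; omega), Finset.sum_eq_zero]
      intro a _
      have ha := a.isLt
      rw [xiMat, if_neg (by omega), zero_mul]
    · rw [Finset.sum_eq_single (⟨n - 1 - k, by omega⟩ : Fin (n - 1))]
      · rw [xiMat, if_pos (by simp only; omega), one_mul, Matrix.submatrix_apply]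
        congr 1
        ext
        simp only [hf]
        omega
      · intro a _ ha
        have ha' := a.isLt
        rw [xiMat, if_neg, zero_mul]
        intro h
        apply ha
        ext
        simp only
        omega
      · simp
  · intro i j hij
    apply h5
    have := i.isLt
    rw [Fin.lt_def] at hij ⊢
    rw [hf, hf]
    omega
  · rw [← Matrix.submatrix_map, h4]
    apply Matrix.submatrix_one
    intro a b hab
    have ha := a.isLt
    have hb := b.isLt
    have := congrArg Fin.val hab
    rw [hf, hf] at this
    ext
    omega

theorem inv_map_aux {R S : Type*} [CommRing R] [CommRing S] (π : R →+* S)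
    {m : Type*} [Fintype m] [DecidableEq m] (A : Matrix m m R) (hu : IsUnit A.det)
    (h : A.map π = 1) : (A⁻¹).map π = 1 := by
  have := congrArg (fun M => M.map π) (Matrix.mul_nonsing_inv A hu)
  simpa [Matrix.map_mul, h] using this

theorem up_mul_aux {R : Type*} [CommRing R] {m : ℕ} (A B : Matrix (Fin m) (Fin m) R)
    (hA : ∀ i j, j < i → A i j = 0) (hB : ∀ i j, j < i → B i j = 0) :
    ∀ i j, j < i → (A * B) i j = 0 := by
  intro i j hij
  have h1 : A.BlockTriangular id := fun i j h => hA i j h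
  have h2 : B.BlockTriangular id := fun i j h => hB i j h
  exact (h1.mul h2) hij

theorem up_inv_aux {R : Type*} [CommRing R] {m : ℕ} (A : Matrix (Fin m) (Fin m) R)
    (hu : IsUnit A.det) (hA : ∀ i j, j < i → A i j = 0) :
    ∀ i j, j < i → A⁻¹ i j = 0 := by
  intro i j hij
  have h1 : A.BlockTriangular id := fun i j h => hA i j h
  let _ := Matrix.invertibleOfIsUnitDet A hu
  exact (Matrix.blockTriangular_inv_of_blockTriangular h1) hij

theorem core2 (p n : ℕ) [Fact p.Prime] {S : Type*} [CommRing S] (π : ℤ_[p] →+* S) [IsLocalHom π]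
    (A : Matrix (Fin (n - 1)) (Fin (n - 1)) ℤ_[p]) (B : Matrix (Fin (n - 1)) (Fin n) ℤ_[p])
    (C : Matrix (Fin n) (Fin (n - 1)) ℤ_[p]) (D : Matrix (Fin n) (Fin n) ℤ_[p])
    (hA : ∀ i j, j < i → π (A i j) = 0) (hD : ∀ i j, j < i → π (D i j) = 0)
    (hC : C.map π = 0) (hAd : IsUnit (A.map π).det) (hDd : IsUnit (D.map π).det) :
    ∃ (h₁ b₁ : Matrix (Fin (n - 1)) (Fin (n - 1)) ℤ_[p]) (h₂ b₂ : Matrix (Fin n) (Fin n) ℤ_[p])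
      (x : Matrix (Fin (n - 1)) (Fin n) ℤ_[p]),
      h₁.map π = 1 ∧ h₂.map π = 1 ∧ (∀ i j, j < i → b₁ i j = 0) ∧ (∀ i j, j < i → b₂ i j = 0) ∧
      uMat p n * Matrix.fromBlocks A B C D =
        blockDiag p n h₁ h₂ * (uMat p n * Matrix.fromBlocks b₁ x 0 b₂) := by
  have uA := det_unit_aux π A hAd
  let T := D - C * A⁻¹ * B
  have hT : T.map π = D.map π := by
    have : (C * A⁻¹ * B).map π = 0 := by rw [Matrix.map_mul, Matrix.map_mul, hC]; simp
    have h2 : T.map π = D.map π - (C * A⁻¹ * B).map π := Matrix.map_sub _ (map_sub π) _ _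
    rw [h2, this, sub_zero]
  have hT' : ∀ i j, π (T i j) = π (D i j) := fun i j => congrFun (congrFun hT i) j
  have hTu : ∀ i j, j < i → π (T i j) = 0 := fun i j h => by rw [hT', hD i j h]
  obtain ⟨L1, U1, a1, -, a3, a4⟩ := lu_aux π _ A hA (diag_unit_aux π A hAd hA)
  obtain ⟨L2, U2, c1, -, c3, c4⟩ := lu_aux π _ T hTu (diag_unit_aux π T (hT ▸ hDd) hTu)
  have uL1 : IsUnit L1.det := det_unit_aux π L1 (by simp [a3])
  have uL2 : IsUnit L2.det := det_unit_aux π L2 (by simp [c3])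
  obtain ⟨K, κ, k1, k2, k3, k4, k5⟩ := core1 p n π (L2⁻¹ * (C * A⁻¹ + xiMat p n) * L1) (by
    rw [Matrix.map_mul, Matrix.map_mul, inv_map_aux π L2 uL2 c3, a3,
      Matrix.map_add _ (map_add π), Matrix.map_mul, hC]
    simp)
  have uK : IsUnit K.det := det_unit_aux π K (by simp [k4])
  have uκ : IsUnit κ.det := det_unit_aux π κ (by simp [k5])
  have key : C * A⁻¹ + xiMat p n = L2 * K * xiMat p n * κ * L1⁻¹ := by
    calc C * A⁻¹ + xiMat p n = (L2 * L2⁻¹) * (C * A⁻¹ + xiMat p n) * (L1 * L1⁻¹) := by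
          rw [Matrix.mul_nonsing_inv _ uL1, Matrix.mul_nonsing_inv _ uL2]; simp
      _ = L2 * (L2⁻¹ * (C * A⁻¹ + xiMat p n) * L1) * L1⁻¹ := by simp only [Matrix.mul_assoc]
      _ = _ := by rw [k1]; simp only [Matrix.mul_assoc]
  refine ⟨L1 * κ⁻¹, κ * U1, L2 * K, K⁻¹ * U2, κ * L1⁻¹ * B, ?_, ?_,
    up_mul_aux _ _ k3 a4, up_mul_aux _ _ (up_inv_aux K uK k2) c4, ?_⟩
  · rw [Matrix.map_mul, a3, inv_map_aux π κ uκ k5, one_mul]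
  · rw [Matrix.map_mul, c3, k4, one_mul]
  have e1 : L1 * κ⁻¹ * (κ * U1) = A := by
    rw [a1, Matrix.mul_assoc, ← Matrix.mul_assoc κ⁻¹, Matrix.nonsing_inv_mul _ uκ, Matrix.one_mul]
  have e2 : L1 * κ⁻¹ * (κ * L1⁻¹ * B) = B := by
    rw [Matrix.mul_assoc, Matrix.mul_assoc κ, ← Matrix.mul_assoc κ⁻¹, Matrix.nonsing_inv_mul _ uκ,
      Matrix.one_mul, ← Matrix.mul_assoc, Matrix.mul_nonsing_inv _ uL1, Matrix.one_mul]
  have e3 : L2 * K * (xiMat p n * (κ * U1)) = xiMat p n * A + C := by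
    calc L2 * K * (xiMat p n * (κ * U1)) = L2 * K * xiMat p n * κ * (L1⁻¹ * L1) * U1 := by
          rw [Matrix.nonsing_inv_mul _ uL1]; simp only [Matrix.mul_assoc, Matrix.one_mul]
      _ = (C * A⁻¹ + xiMat p n) * A := by
          rw [key]; conv_rhs => rw [a1]
          simp only [Matrix.mul_assoc]
      _ = _ := by
          rw [Matrix.add_mul, Matrix.mul_assoc, Matrix.nonsing_inv_mul _ uA, Matrix.mul_one,
            add_comm]
  have e4 : L2 * K * (xiMat p n * (κ * L1⁻¹ * B)) = C * A⁻¹ * B + xiMat p n * B := by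
    rw [← Matrix.add_mul, key]; simp only [Matrix.mul_assoc]
  have e5 : L2 * K * (K⁻¹ * U2) = D - C * A⁻¹ * B := by
    rw [Matrix.mul_assoc, ← Matrix.mul_assoc K, Matrix.mul_nonsing_inv _ uK, Matrix.one_mul, ← c1]
  simp only [uMat, blockDiag, Matrix.fromBlocks_multiply, Matrix.one_mul, Matrix.zero_mul,
    Matrix.mul_zero, add_zero, zero_add, Matrix.mul_add, e1, e2, e3, e4, e5]
  congr 1
  abel

/-- For `g ∈ GL_{2n−1}(ℤ_p)`: `g` is upper triangular mod `p^r`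
iff `g = u⁻¹·diag(h₁,h₂)·u·b` with `b` upper triangular and `diag(h₁,h₂)`
congruent mod `p^r` to a diagonal matrix `diag(y_1, …, y_{2n−1})` of units
satisfying `y_i = y_{2n−i}`. -/
theorem stmt4 (p : ℕ) [Fact p.Prime] (n r : ℕ) (hn : 1 ≤ n) (hr : 1 ≤ r)
    (g : GL (Fin (n - 1) ⊕ Fin n) ℤ_[p]) :
    (∀ i j : Fin (n - 1) ⊕ Fin n, eF n j < eF n i →
      (p : ℤ_[p]) ^ r ∣
        (g : Matrix (Fin (n - 1) ⊕ Fin n) (Fin (n - 1) ⊕ Fin n) ℤ_[p]) i j) ↔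
    (∃ (h₁ : GL (Fin (n - 1)) ℤ_[p]) (h₂ : GL (Fin n) ℤ_[p])
        (y : Fin (2 * n - 1) → ℤ_[p]ˣ) (b : GL (Fin (n - 1) ⊕ Fin n) ℤ_[p]),
      (∀ i : Fin (2 * n - 1), y i = y ⟨2 * n - 2 - (i : ℕ), by have := i.isLt; omega⟩) ∧
      (∀ i j : Fin (n - 1) ⊕ Fin n, eF n j < eF n i →
        (b : Matrix (Fin (n - 1) ⊕ Fin n) (Fin (n - 1) ⊕ Fin n) ℤ_[p]) i j = 0) ∧
      (∀ i j : Fin (n - 1) ⊕ Fin n, (p : ℤ_[p]) ^ r ∣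
        (blockDiag p n (h₁ : Matrix (Fin (n - 1)) (Fin (n - 1)) ℤ_[p])
            (h₂ : Matrix (Fin n) (Fin n) ℤ_[p]) i j
          - Matrix.diagonal (fun k => (y (eF n k) : ℤ_[p])) i j)) ∧
      (g : Matrix (Fin (n - 1) ⊕ Fin n) (Fin (n - 1) ⊕ Fin n) ℤ_[p]) =
        (uMat p n)⁻¹ *
          blockDiag p n (h₁ : Matrix (Fin (n - 1)) (Fin (n - 1)) ℤ_[p])
            (h₂ : Matrix (Fin n) (Fin n) ℤ_[p]) *
          uMat p n *
          (b : Matrix (Fin (n - 1) ⊕ Fin n) (Fin (n - 1) ⊕ Fin n) ℤ_[p])) := by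
  have hpm : (p : ℤ_[p]) ^ r ∈ IsLocalRing.maximalIdeal ℤ_[p] := by
    apply Ideal.pow_mem_of_mem _ _ r hr
    rw [PadicInt.maximalIdeal_eq_span_p]
    exact Ideal.mem_span_singleton_self _
  have huu : IsUnit (uMat p n).det := by simp [uMat]
  have e_lt_l : ∀ i j : Fin (n - 1), eF n (Sum.inl j) < eF n (Sum.inl i) ↔ j < i := by
    intro i j; simp [eF]
  have e_lt_r : ∀ i j : Fin n, eF n (Sum.inr j) < eF n (Sum.inr i) ↔ j < i := by
    intro i j; simp [eF]
  have e_lr : ∀ (i : Fin (n - 1)) (j : Fin n), eF n (Sum.inl i) < eF n (Sum.inr j) := by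
    intro i j
    have := i.isLt
    simp only [eF, Fin.lt_def, Sum.elim_inl, Sum.elim_inr]
    omega
  constructor
  · intro hg
    let I : Ideal ℤ_[p] := Ideal.span {(p : ℤ_[p]) ^ r}
    let π := Ideal.Quotient.mk I
    have : IsLocalHom π := isLocalHom_of_le_jacobson_bot I (by
      rw [IsLocalRing.jacobson_eq_maximalIdeal _ bot_ne_top, Ideal.span_singleton_le_iff_mem]
      exact hpm)
    have hπ : ∀ x, π x = 0 ↔ (p : ℤ_[p]) ^ r ∣ x := fun x => by
      rw [Ideal.Quotient.eq_zero_iff_mem, Ideal.mem_span_singleton]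
    let G : Matrix (Fin (n - 1) ⊕ Fin n) (Fin (n - 1) ⊕ Fin n) ℤ_[p] := g
    have hGd : IsUnit G.det := Matrix.isUnits_det_units g
    have hG : Matrix.fromBlocks G.toBlocks₁₁ G.toBlocks₁₂ G.toBlocks₂₁ G.toBlocks₂₂ = G :=
      Matrix.fromBlocks_toBlocks G
    have hC : G.toBlocks₂₁.map π = 0 := by
      ext i j
      exact (hπ _).2 (hg _ _ (e_lr j i))
    have hdet : IsUnit ((G.toBlocks₁₁.map π).det * (G.toBlocks₂₂.map π).det) := by
      have h1 : IsUnit (π G.det) := hGd.map π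
      rw [RingHom.map_det, RingHom.mapMatrix_apply, ← hG, Matrix.fromBlocks_map, hC,
        Matrix.det_fromBlocks_zero₂₁] at h1
      exact h1
    obtain ⟨h₁, b₁, h₂, b₂, x, m1, m2, t1, t2, E⟩ := core2 p n π G.toBlocks₁₁ G.toBlocks₁₂
      G.toBlocks₂₁ G.toBlocks₂₂
      (fun i j h => (hπ _).2 (hg _ _ ((e_lt_l i j).2 h)))
      (fun i j h => (hπ _).2 (hg _ _ ((e_lt_r i j).2 h))) hC
      (isUnit_of_mul_isUnit_left hdet) (isUnit_of_mul_isUnit_right hdet)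
    rw [hG] at E
    have u1 : IsUnit h₁.det := det_unit_aux π h₁ (by simp [m1])
    have u2 : IsUnit h₂.det := det_unit_aux π h₂ (by simp [m2])
    have ub : IsUnit (Matrix.fromBlocks b₁ x 0 b₂).det := by
      have h1 : IsUnit (uMat p n * G).det := by rw [Matrix.det_mul]; exact huu.mul hGd
      rw [E, Matrix.det_mul, Matrix.det_mul] at h1
      exact isUnit_of_mul_isUnit_right (isUnit_of_mul_isUnit_right h1)
    refine ⟨Matrix.nonsingInvUnit h₁ u1, Matrix.nonsingInvUnit h₂ u2, fun _ => 1,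
      Matrix.nonsingInvUnit _ ub, fun _ => rfl, ?_, ?_, ?_⟩
    · intro i j h
      change Matrix.fromBlocks b₁ x 0 b₂ i j = 0
      rcases i with i | i <;> rcases j with j | j
      · exact t1 i j ((e_lt_l i j).1 h)
      · exact absurd h (e_lr i j).not_gt
      · rfl
      · exact t2 i j ((e_lt_r i j).1 h)
    · intro i j
      change _ ∣ Matrix.fromBlocks h₁ 0 0 h₂ i j - _
      rw [← hπ]
      have m1' := fun i j => congrFun (congrFun m1 i) j
      have m2' := fun i j => congrFun (congrFun m2 i) j
      simp only [Matrix.map_apply] at m1' m2'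
      rcases i with i | i <;> rcases j with j | j <;>
        simp [m1', m2', Matrix.one_apply, apply_ite π]
    · change G = (uMat p n)⁻¹ * blockDiag p n h₁ h₂ * uMat p n * Matrix.fromBlocks b₁ x 0 b₂
      rw [Matrix.mul_assoc, Matrix.mul_assoc, ← E, ← Matrix.mul_assoc,
        Matrix.nonsing_inv_mul _ huu, Matrix.one_mul]
  · rintro ⟨h₁, h₂, y, b, hy, hb, hH, hg⟩ i j hij
    choose X hX using hH
    let Y : Matrix (Fin (n - 1) ⊕ Fin n) (Fin (n - 1) ⊕ Fin n) ℤ_[p] :=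
      Matrix.diagonal (fun k => (y (eF n k) : ℤ_[p]))
    have hHe : blockDiag p n (h₁ : Matrix (Fin (n - 1)) (Fin (n - 1)) ℤ_[p])
            (h₂ : Matrix (Fin n) (Fin n) ℤ_[p]) = Y + (p : ℤ_[p]) ^ r • Matrix.of X := by
      ext i j
      have := hX i j
      simp only [Matrix.add_apply, Matrix.smul_apply, Matrix.of_apply, smul_eq_mul, ← this, Y]
      ring
    have hYu : Y * uMat p n = uMat p n * Y := by
      ext i j
      rw [Matrix.diagonal_mul, Matrix.mul_diagonal, mul_comm]
      rcases i with i | i <;> rcases j with j | j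
      · simp only [uMat, Matrix.fromBlocks_apply₁₁, Matrix.one_apply]
        split_ifs with h
        · rw [h]
        · simp
      · simp [uMat]
      · simp only [uMat, Matrix.fromBlocks_apply₂₁, xiMat]
        split_ifs with h
        · rw [hy (eF n (Sum.inr i))]
          congr 3
          ext
          simp only [eF, Sum.elim_inl, Sum.elim_inr]
          omega
        · simp
      · simp only [uMat, Matrix.fromBlocks_apply₂₂, Matrix.one_apply]
        split_ifs with h
        · rw [h]
        · simp
    have hge : (g : Matrix (Fin (n - 1) ⊕ Fin n) (Fin (n - 1) ⊕ Fin n) ℤ_[p]) =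
        Y * b + (p : ℤ_[p]) ^ r • ((uMat p n)⁻¹ * Matrix.of X * uMat p n * b) := by
      rw [hg, hHe, Matrix.mul_add, Matrix.add_mul, Matrix.add_mul, Matrix.mul_assoc _ Y, hYu,
        ← Matrix.mul_assoc _ _ Y, Matrix.nonsing_inv_mul _ huu, Matrix.one_mul, Matrix.mul_smul,
        Matrix.smul_mul, Matrix.smul_mul]
    rw [hge, Matrix.add_apply, Matrix.diagonal_mul, hb i j hij, mul_zero, zero_add,
      Matrix.smul_apply, smul_eq_mul]
    exact dvd_mul_right _ _
end

section
/- Let p be a prime and let n ≥ 1 and r ≥ 1 be integers. For a pair (x, g) ∈ ℤ_p^× × GL_{2n−1}(ℤ_p) the following are equivalent: (i) g is upper triangular mod p^r; (ii) there exist h₀ ∈ ℤ_p^×, h₁ ∈ GL_{n−1}(ℤ_p), h₂ ∈ GL_n(ℤ_p), units y_1, …, y_{2n} ∈ ℤ_p^× satisfying y_1 = y_{n+1} and y_i = y_{2n+2−i} for all 2 ≤ i ≤ 2n, an element b₀ ∈ ℤ_p^×, and an upper triangular b ∈ GL_{2n−1}(ℤ_p), such that h₀ ≡ y_1 mod p^r,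 diag(h₁,h₂) ≡ diag(y_2, …, y_{2n}) mod p^r, x = h₀·b₀, and g = u^{-1}·diag(h₁,h₂)·u·b. -/
section aux
variable {R S : Type*} [CommRing R] [CommRing S] (π : R →+* S) [IsLocalHom π]

theorem aux_lu_s6 (m : ℕ) : ∀ X : Matrix (Fin m) (Fin m) R, (∀ i, IsUnit (X i i)) →
    (∀ i j, j < i → π (X i j) = 0) →
    ∃ N B : Matrix (Fin m) (Fin m) R, X = N * B ∧ N.map π = 1 ∧ (∀ i j, i < j → N i j = 0) ∧
      (∀ i j, j < i → B i j = 0) := by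
  induction m with
  | zero => 
    intro X _ _
    exact ⟨1, 1, by ext i; exact i.elim0, by ext i; exact i.elim0, fun i => i.elim0,
      fun i => i.elim0⟩
  | succ m ih =>
    intro X hd hl
    obtain ⟨a, ha⟩ := hd 0
    have hc : ∀ i : Fin m, π (X i.succ 0) = 0 := fun i => hl _ _ (Fin.succ_pos i)
    obtain ⟨N, B, h1, h2, h3, h4⟩ := ih
      (Matrix.of fun i j => X i.succ j.succ - X i.succ 0 * (↑a⁻¹ : R) * X 0 j.succ)
      (fun i => by
        apply isUnit_of_map_unit π
        simp only [Matrix.of_apply, map_sub, map_mul, hc, zero_mul, sub_zero]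
        exact (hd _).map π)
      (fun i j hij => by
        simp only [Matrix.of_apply, map_sub, map_mul, hc, zero_mul, sub_zero]
        exact hl _ _ (Fin.succ_lt_succ_iff.2 hij))
    refine ⟨Matrix.of fun i j => Fin.cases (Fin.cases 1 (fun _ => 0) j)
        (fun i' => Fin.cases (X i'.succ 0 * (↑a⁻¹ : R)) (fun j' => N i' j') j) i,
      Matrix.of fun i j => Fin.cases (X 0 j) (fun i' => Fin.cases 0 (fun j' => B i' j') j) i,
      ?_, ?_, ?_, ?_⟩
    · ext i j
      rw [Matrix.mul_apply, Fin.sum_univ_succ]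
      refine Fin.cases ?_ (fun i => ?_) i
      · simp
      · refine Fin.cases ?_ (fun j => ?_) j
        · simp [← ha]
        · have := congrFun (congrFun h1 i) j
          rw [Matrix.mul_apply] at this
          simp only [Matrix.of_apply, Fin.cases_zero, Fin.cases_succ]
          rw [← this]
          simp
    · ext i j
      have := fun i j => congrFun (congrFun h2 i) j
      simp only [Matrix.map_apply, Matrix.one_apply] at this
      refine Fin.cases ?_ (fun i => ?_) i <;> refine Fin.cases ?_ (fun j => ?_) j <;>
        simp [Matrix.one_apply, hc, this, Fin.succ_ne_zero, (Fin.succ_ne_zero _).symm]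
    · intro i j
      refine Fin.cases ?_ (fun i => ?_) i <;> refine Fin.cases ?_ (fun j => ?_) j
      · simp
      · simp
      · simp
      · simpa using h3 i j
    · intro i j
      refine Fin.cases ?_ (fun i => ?_) i <;> refine Fin.cases ?_ (fun j => ?_) j
      · simp
      · simp
      · simp
      · simpa using h4 i j

theorem aux_unit_s6 {ι : Type*} [Fintype ι] [DecidableEq ι] {X : Matrix ι ι R}
    (h : X.map π = 1) : IsUnit X.det := by
  apply isUnit_of_map_unit π
  rw [RingHom.map_det, RingHom.mapMatrix_apply, h]
  simp

theorem aux_inv {ι : Type*} [Fintype ι] [DecidableEq ι] {X : Matrix ι ι R}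
    (h : X.map π = 1) : X⁻¹.map π = 1 := by
  have := congrArg (fun Y => Y.map π) (Matrix.mul_nonsing_inv X (aux_unit_s6 π h))
  simpa [Matrix.map_mul, h] using this

/-- generic xi -/
def xiG (R : Type*) [CommRing R] (k : ℕ) : Matrix (Fin (k+1)) (Fin k) R :=
  fun i j => if (i : ℕ) + (j : ℕ) + 1 = k + 1 then 1 else 0

theorem aux_core (k : ℕ) (P : Matrix (Fin k) (Fin k) R) (Q : Matrix (Fin k) (Fin (k+1)) R)
    (T : Matrix (Fin (k+1)) (Fin k) R) (V : Matrix (Fin (k+1)) (Fin (k+1)) R)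
    (hP : P.map π = 1) (hT : T.map π = 0) (hV : V.map π = 1) :
    ∃ (h1 A : Matrix (Fin k) (Fin k) R) (h2 D : Matrix (Fin (k+1)) (Fin (k+1)) R)
      (B : Matrix (Fin k) (Fin (k+1)) R),
      h1.map π = 1 ∧ h2.map π = 1 ∧ A.map π = 1 ∧ D.map π = 1 ∧
      (∀ i j, j < i → A i j = 0) ∧ (∀ i j, j < i → D i j = 0) ∧
      Matrix.fromBlocks P Q T V * Matrix.fromBlocks A B 0 D =
        Matrix.fromBlocks h1 0 (h2 * xiG R k - xiG R k * h1) h2 := by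
  have hPu := aux_unit_s6 π hP
  set W := V - T * P⁻¹ * Q with hW
  have hWm : W.map π = 1 := by
    rw [hW, Matrix.map_sub _ (map_sub π), Matrix.map_mul, Matrix.map_mul, hT, hV]; simp
  have hWu := aux_unit_s6 π hWm
  set M := W⁻¹ * (T + xiG R k * P) with hM
  have hMm : M.map π = xiG S k := by
    rw [hM, Matrix.map_mul, aux_inv π hWm, Matrix.map_add _ (map_add π), Matrix.map_mul, hP, hT]
    ext i j
    simp [xiG, apply_ite π]
  have hMe : ∀ i j, π (M i j) = if (i : ℕ) + (j : ℕ) + 1 = k + 1 then 1 else 0 :=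
    fun i j => congrFun (congrFun hMm i) j
  let X : Matrix (Fin k) (Fin k) R := Matrix.of fun i j => M (Fin.rev i.castSucc) j
  have hXe : ∀ i j, π (X i j) = if i = j then 1 else 0 := by
    intro i j
    simp only [X, Matrix.of_apply, hMe, Fin.val_rev, Fin.val_castSucc, Fin.ext_iff]
    congr 1
    apply propext; omega
  have hXm : X.map π = 1 := by
    ext i j; simp [hXe, Matrix.one_apply]
  obtain ⟨L, U, h, hL, hL0, hU0⟩ := aux_lu_s6 π k X
    (fun i => isUnit_of_map_unit π _ (by simp [hXe]))
    (fun i j hij => by rw [hXe, if_neg hij.ne'])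
  have hU : U.map π = 1 := by
    have := hXm
    rw [h, Matrix.map_mul, hL] at this
    simpa using this
  have hUu := aux_unit_s6 π hU
  have hA : U⁻¹.map π = 1 := aux_inv π hU
  have hUt : Matrix.BlockTriangular U id := fun i j hij => hU0 i j hij
  have hAt : Matrix.BlockTriangular U⁻¹ id := by
    haveI := Matrix.invertibleOfIsUnitDet U hUu
    exact Matrix.blockTriangular_inv_of_blockTriangular hUt
  have hXA : X * U⁻¹ = L := by rw [h, Matrix.mul_nonsing_inv_cancel_right _ _ hUu]
  let D : Matrix (Fin (k+1)) (Fin (k+1)) R := Matrix.of fun i j =>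
    Fin.cases (if i = 0 then 1 else 0) (fun j' => (M * U⁻¹) i (Fin.rev j')) j
  have hMA : (M * U⁻¹).map π = xiG S k := by
    rw [Matrix.map_mul, hMm, hA, Matrix.mul_one]
  have hD : D.map π = 1 := by
    ext i j
    refine Fin.cases ?_ (fun j => ?_) j
    · simp [D, Matrix.one_apply, apply_ite π]
    · have := congrFun (congrFun hMA i) (Fin.rev j)
      simp only [Matrix.map_apply] at this
      simp only [D, Matrix.map_apply, Matrix.of_apply, Fin.cases_succ, this, xiG,
        Matrix.one_apply, Fin.ext_iff, Fin.val_rev, Fin.val_succ]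
      congr 1
      apply propext; omega
  have hD0 : ∀ i j, j < i → D i j = 0 := by
    intro i j
    refine Fin.cases ?_ (fun j => ?_) j
    · intro hi; simp [D, hi.ne']
    · intro hi
      simp only [Fin.lt_def, Fin.val_succ] at hi
      have hik := i.isLt
      have h5 := hL0 ⟨k - i, by omega⟩ (Fin.rev j) (by simp [Fin.lt_def]; omega)
      rw [← hXA] at h5
      simp only [D, Matrix.of_apply, Fin.cases_succ]
      rw [← h5, Matrix.mul_apply, Matrix.mul_apply]
      refine Finset.sum_congr rfl fun l _ => ?_
      simp only [X, Matrix.of_apply]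
      congr 2
      apply Fin.ext; simp; omega
  have hDx : D * xiG R k = M * U⁻¹ := by
    ext i j
    rw [Matrix.mul_apply, Finset.sum_eq_single (Fin.succ (Fin.rev j))]
    · simp only [D, xiG, Matrix.of_apply, Fin.cases_succ, Fin.rev_rev, Fin.val_succ, Fin.val_rev]
      rw [if_pos (by omega), mul_one]
    · intro l _ hl
      rw [xiG, if_neg, mul_zero]
      intro h; apply hl; apply Fin.ext; simp; omega
    · simp
  refine ⟨P * U⁻¹, U⁻¹, W * D, D, -(P⁻¹ * Q * D), ?_, ?_, hA, hD, fun i j hij => hAt hij, hD0, ?_⟩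
  · rw [Matrix.map_mul, hP, hA, Matrix.mul_one]
  · rw [Matrix.map_mul, hWm, hD, Matrix.mul_one]
  · rw [Matrix.fromBlocks_multiply]
    congr 1
    · simp
    · rw [Matrix.mul_neg, Matrix.mul_assoc, Matrix.mul_nonsing_inv_cancel_left _ _ hPu]; simp
    · rw [Matrix.mul_assoc W, hDx, hM, ← Matrix.mul_assoc W, Matrix.mul_nonsing_inv_cancel_left _ _ hWu]
      simp [Matrix.add_mul, Matrix.mul_assoc]
    · rw [hW, Matrix.sub_mul, Matrix.mul_neg]; simp only [Matrix.mul_assoc]; abel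

end aux

theorem eF_bij (n : ℕ) : Function.Bijective (eF n) := by
  rw [Fintype.bijective_iff_injective_and_card]
  constructor
  · rintro (a | a) (b | b) h <;> simp [eF, Fin.ext_iff] at h ⊢ <;> omega
  · simp; omega

theorem uMat_inv (p n : ℕ) [Fact p.Prime] :
    (uMat p n)⁻¹ = Matrix.fromBlocks 1 0 (-xiMat p n) 1 := by
  apply Matrix.inv_eq_left_inv
  simp [uMat, Matrix.fromBlocks_multiply]

theorem aux_iwahori {R S : Type*} [CommRing R] [CommRing S] (π : R →+* S) [IsLocalHom π]
    {ι : Type*} [Fintype ι] [DecidableEq ι] {m : ℕ} (e : ι ≃ Fin m) (g : Matrix ι ι R)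
    (hg : IsUnit g.det) (h : ∀ i j, e j < e i → π (g i j) = 0) :
    ∃ N B : Matrix ι ι R, g = N * B ∧ N.map π = 1 ∧ (∀ i j, e j < e i → B i j = 0) := by
  have ht : ∀ i j : Fin m, j < i → π (g (e.symm i) (e.symm j)) = 0 :=
    fun i j hij => h _ _ (by simpa using hij)
  have hu : ∀ i, IsUnit (g (e.symm i) (e.symm i)) := by
    have h1 : ((g.submatrix e.symm e.symm).map π).BlockTriangular id := fun i j hij => ht i j hij
    have h2 := Matrix.det_of_upperTriangular h1
    have h3 : IsUnit ((g.submatrix e.symm e.symm).map π).det := by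
      rw [← RingHom.mapMatrix_apply, ← RingHom.map_det, Matrix.det_submatrix_equiv_self]
      exact hg.map π
    rw [h2, IsUnit.prod_univ_iff] at h3
    exact fun i => isUnit_of_map_unit π _ (h3 i)
  obtain ⟨N, B, h1, h2, -, h4⟩ := aux_lu_s6 π m (g.submatrix e.symm e.symm) hu ht
  refine ⟨N.submatrix e e, B.submatrix e e, ?_, ?_, fun i j hij => h4 _ _ hij⟩
  · rw [Matrix.submatrix_mul_equiv, ← h1]; simp
  · rw [← Matrix.submatrix_map, h2]; simp

/-- Box decomposition for `GL_1 × GL_{2n−1}` relative to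
`H = GL_1 × GL_{n−1} × GL_n` and the torus `T^◇` (given by `y_1 = y_{n+1}` and
`y_i = y_{2n+2−i}` for `2 ≤ i ≤ 2n`), on `ℤ_p`-points. -/
theorem stmt6 (p : ℕ) [Fact p.Prime] (n r : ℕ) (hn : 1 ≤ n) (hr : 1 ≤ r)
    (x : ℤ_[p]ˣ) (g : GL (Fin (n - 1) ⊕ Fin n) ℤ_[p]) :
    (∀ i j : Fin (n - 1) ⊕ Fin n, eF n j < eF n i →
      (p : ℤ_[p]) ^ r ∣
        (g : Matrix (Fin (n - 1) ⊕ Fin n) (Fin (n - 1) ⊕ Fin n) ℤ_[p]) i j) ↔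
    (∃ (h₀ : ℤ_[p]ˣ) (h₁ : GL (Fin (n - 1)) ℤ_[p]) (h₂ : GL (Fin n) ℤ_[p])
        (y : Fin (2 * n) → ℤ_[p]ˣ) (b₀ : ℤ_[p]ˣ) (b : GL (Fin (n - 1) ⊕ Fin n) ℤ_[p]),
      y ⟨0, by omega⟩ = y ⟨n, by omega⟩ ∧
      (∀ i : Fin (2 * n), ∀ _h : 1 ≤ (i : ℕ),
        y i = y ⟨2 * n - (i : ℕ), by have := i.isLt; omega⟩) ∧
      (∀ i j : Fin (n - 1) ⊕ Fin n, eF n j < eF n i →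
        (b : Matrix (Fin (n - 1) ⊕ Fin n) (Fin (n - 1) ⊕ Fin n) ℤ_[p]) i j = 0) ∧
      (p : ℤ_[p]) ^ r ∣ ((h₀ : ℤ_[p]) - (y ⟨0, by omega⟩ : ℤ_[p])) ∧
      (∀ i j : Fin (n - 1) ⊕ Fin n, (p : ℤ_[p]) ^ r ∣
        (blockDiag p n (h₁ : Matrix (Fin (n - 1)) (Fin (n - 1)) ℤ_[p])
            (h₂ : Matrix (Fin n) (Fin n) ℤ_[p]) i j
          - Matrix.diagonal
              (fun k => (y ⟨(eF n k : ℕ) + 1, by have := (eF n k).isLt; omega⟩ : ℤ_[p])) i j)) ∧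
      x = h₀ * b₀ ∧
      (g : Matrix (Fin (n - 1) ⊕ Fin n) (Fin (n - 1) ⊕ Fin n) ℤ_[p]) =
        (uMat p n)⁻¹ *
          blockDiag p n (h₁ : Matrix (Fin (n - 1)) (Fin (n - 1)) ℤ_[p])
            (h₂ : Matrix (Fin n) (Fin n) ℤ_[p]) *
          uMat p n *
          (b : Matrix (Fin (n - 1) ⊕ Fin n) (Fin (n - 1) ⊕ Fin n) ℤ_[p])) := by
  have hd : ¬ IsUnit ((p : ℤ_[p]) ^ r) := by
    rw [isUnit_pow_iff (by omega)]
    exact PadicInt.prime_p.not_unit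
  constructor
  · intro h
    let π := Ideal.Quotient.mk (Ideal.span {(p : ℤ_[p]) ^ r})
    have hπ : ∀ a, π a = 0 ↔ (p : ℤ_[p]) ^ r ∣ a := fun a => by
      rw [Ideal.Quotient.eq_zero_iff_mem, Ideal.mem_span_singleton]
    have hnt : Nontrivial (ℤ_[p] ⧸ Ideal.span {(p : ℤ_[p]) ^ r}) :=
      Ideal.Quotient.nontrivial_iff.2 (by rwa [Ne, Ideal.span_singleton_eq_top])
    have : IsLocalHom π := IsLocalHom.of_surjective π Ideal.Quotient.mk_surjective
    have hcong : ∀ {ι : Type} [DecidableEq ι] (X : Matrix ι ι ℤ_[p]), X.map π = 1 →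
        ∀ i j, (p : ℤ_[p]) ^ r ∣ X i j - (1 : Matrix ι ι ℤ_[p]) i j := by
      intro ι _ X hX i j
      rw [← hπ, map_sub, sub_eq_zero]
      have := congrFun (congrFun hX i) j
      rw [Matrix.map_apply] at this
      rw [this]; simp [Matrix.one_apply, apply_ite π]
    obtain ⟨k, rfl⟩ : ∃ k, n = k + 1 := ⟨n - 1, by omega⟩
    obtain ⟨N, B0, hg, hN, hB0⟩ := aux_iwahori π (Equiv.ofBijective _ (eF_bij (k+1))) g.1
      (Matrix.isUnits_det_units g) (fun i j hij => (hπ _).2 (h i j hij))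
    simp only [Equiv.ofBijective_apply] at hB0
    have hNe := fun i j => congrFun (congrFun hN i) j
    simp only [Matrix.map_apply] at hNe
    obtain ⟨h1, A, h2, D, B, e1, e2, eA, eD, tA, tD, key⟩ := aux_core π k N.toBlocks₁₁ N.toBlocks₁₂
      N.toBlocks₂₁ N.toBlocks₂₂
      (by ext i j; simp only [Matrix.map_apply, Matrix.toBlocks₁₁, Matrix.of_apply, hNe]
          simp [Matrix.one_apply])
      (by ext i j; simp only [Matrix.map_apply, Matrix.toBlocks₂₁, Matrix.of_apply, hNe]
          simp [Matrix.one_apply])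
      (by ext i j; simp only [Matrix.map_apply, Matrix.toBlocks₂₂, Matrix.of_apply, hNe]
          simp [Matrix.one_apply])
    rw [Matrix.fromBlocks_toBlocks] at key
    let C : Matrix (Fin (k + 1 - 1) ⊕ Fin (k + 1)) (Fin (k + 1 - 1) ⊕ Fin (k + 1)) ℤ_[p] :=
      Matrix.fromBlocks A B 0 D
    have hCu : IsUnit C.det := by
      simp only [C, Matrix.det_fromBlocks_zero₂₁]
      exact (aux_unit_s6 π eA).mul (aux_unit_s6 π eD)
    have hCt : C.BlockTriangular (eF (k+1)) := by
      rintro (i | i) (j | j) hij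
      · exact tA i j (by
          change (⟨(j : ℕ), _⟩ : Fin (2 * (k+1) - 1)) < ⟨(i : ℕ), _⟩ at hij
          exact hij)
      · simp [eF, Fin.lt_def] at hij; omega
      · rfl
      · exact tD i j (by
          change k + 1 - 1 + (j : ℕ) < k + 1 - 1 + (i : ℕ) at hij
          rw [Fin.lt_def]; omega)
    haveI := Matrix.invertibleOfIsUnitDet C hCu
    have hCit := Matrix.blockTriangular_inv_of_blockTriangular hCt
    have hB0u : IsUnit B0.det := by
      have := Matrix.isUnits_det_units g
      rw [hg, Matrix.det_mul] at this
      exact isUnit_of_mul_isUnit_right this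
    have hbu : IsUnit (C⁻¹ * B0).det := by
      rw [Matrix.det_mul]
      exact ((Matrix.isUnit_nonsing_inv_det_iff).2 hCu).mul hB0u
    refine ⟨1, Matrix.nonsingInvUnit h1 (aux_unit_s6 π e1), Matrix.nonsingInvUnit h2 (aux_unit_s6 π e2),
      fun _ => 1, x, Matrix.nonsingInvUnit _ hbu, rfl, fun _ _ => rfl, ?_, by simp, ?_, by simp, ?_⟩
    · intro i j hij
      exact hCit.mul (fun i j hij => hB0 i j hij) hij
    · intro i j
      have hh : (blockDiag p (k+1) h1 h2).map π = 1 := by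
        simp only [blockDiag, Matrix.fromBlocks_map]
        rw [← Matrix.fromBlocks_one]
        congr 1 <;> simp
      have := hcong _ hh i j
      have h1' : (fun _ => ((1 : ℤ_[p]ˣ) : ℤ_[p])) = (1 : Fin (k+1-1) ⊕ Fin (k+1) → ℤ_[p]) := by
        ext; simp
      rw [h1', Matrix.diagonal_one']
      exact this
    · have hu : (uMat p (k+1))⁻¹ * blockDiag p (k+1) h1 h2 * uMat p (k+1) = N * C := by
        have hx : xiMat p (k+1) = xiG ℤ_[p] k := rfl
        rw [uMat_inv, hx]
        refine Eq.trans ?_ key.symm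
        simp only [uMat, blockDiag, hx]
        rw [Matrix.fromBlocks_multiply, Matrix.fromBlocks_multiply]
        congr 1 <;> simp
        abel
      change g.1 = (uMat p (k+1))⁻¹ * blockDiag p (k+1) h1 h2 * uMat p (k+1) * (C⁻¹ * B0)
      rw [hu, hg, Matrix.mul_assoc, Matrix.mul_nonsing_inv_cancel_left _ _ hCu]
  · rintro ⟨h₀, h₁, h₂, y, b₀, b, -, hy, hb, -, hD, -, hg⟩ i j hij
    set Y : Fin (n-1) ⊕ Fin n → ℤ_[p] :=
      fun k => (y ⟨(eF n k : ℕ) + 1, by have := (eF n k).isLt; omega⟩ : ℤ_[p]) with hY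
    choose E hE using hD
    have hH : blockDiag p n h₁.1 h₂.1 = Matrix.diagonal Y + (p : ℤ_[p]) ^ r • Matrix.of E := by
      ext i j
      have := hE i j
      simp only [Matrix.add_apply, Matrix.smul_apply, Matrix.of_apply, smul_eq_mul]
      rw [← this]; ring
    have hcomm : Matrix.diagonal Y * uMat p n = uMat p n * Matrix.diagonal Y := by
      ext i j
      rw [Matrix.diagonal_mul, Matrix.mul_diagonal]
      rcases i with i | i <;> rcases j with j | j
      · simp only [uMat, Matrix.fromBlocks_apply₁₁, Matrix.one_apply]
        split_ifs with h
        · subst h; ring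
        · simp
      · simp [uMat]
      · simp only [uMat, Matrix.fromBlocks_apply₂₁, xiMat]
        split_ifs with h
        · have := hy ⟨(j : ℕ) + 1, by omega⟩ (by simp)
          simp only [hY, eF, Sum.elim_inl, Sum.elim_inr, this, mul_one, one_mul]
          congr 3
          omega
        · simp
      · simp only [uMat, Matrix.fromBlocks_apply₂₂, Matrix.one_apply]
        split_ifs with h
        · subst h; ring
        · simp
    have huu : IsUnit (uMat p n).det := by simp [uMat]
    have : g.1 = Matrix.diagonal Y * b.1 +
        (p : ℤ_[p]) ^ r • ((uMat p n)⁻¹ * Matrix.of E * uMat p n * b.1) := by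
      rw [hg, hH]
      simp only [Matrix.mul_add, Matrix.add_mul, Matrix.mul_smul, Matrix.smul_mul]
      rw [Matrix.mul_assoc _ (Matrix.diagonal Y), hcomm, Matrix.nonsing_inv_mul_cancel_left _ _ huu]
    rw [this, Matrix.add_apply, Matrix.diagonal_mul, hb i j hij, mul_zero, zero_add]
    exact ⟨_, rfl⟩
end

section
/- Let k be a field and n ≥ 1 an integer. Define ι̂ : k^n → k^{2n} (coordinates indexed 0, …, 2n−1) by ι̂(y_0, …, y_{n−1}) = (y_1, y_2, …, y_{n−1}, 0, y_0 − (y_1 + ⋯ + y_{n−1}), −y_{n−1}, −y_{n−2}, …, −y_1). For 0 ≤ i ≤ 2n−1 let C_i ⊆ k^{2n} be the set of vectors v with v_i ≠ 0 and v_j = 0 for all j > i. Then for every i with 0 ≤ i < n and every nonzero y ∈ k^n, ι̂(y) ∉ C_i. -/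
/-- The coordinate expression of the twisted embedding of flag varieties:
`ι̂(y_0, …, y_{n−1}) = (y_1, …, y_{n−1}, 0, y_0 − (y_1 + ⋯ + y_{n−1}),
−y_{n−1}, …, −y_1)`, with coordinates indexed `0, …, 2n−1`. -/
def iotaHat (k : Type*) [Field k] (n : ℕ) (y : Fin n → k) : Fin (2 * n) → k := fun j =>
  if h1 : (j : ℕ) < n - 1 then y ⟨(j : ℕ) + 1, by omega⟩
  else if h2 : (j : ℕ) = n - 1 then 0
  else if h3 : (j : ℕ) = n then
    y ⟨0, by have := j.isLt; omega⟩ -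
      ∑ m : Fin (n - 1), y ⟨(m : ℕ) + 1, by have := m.isLt; omega⟩
  else -y ⟨2 * n - (j : ℕ), by have := j.isLt; omega⟩

/-- The image of a nonzero vector under `ι̂` never lies in a
Bruhat cell `C_i` with `i < n`, where `C_i` is the set of vectors `v` with
`v_i ≠ 0` and `v_j = 0` for all `j > i`. -/
theorem stmt10 (k : Type*) [Field k] (n : ℕ) (hn : 1 ≤ n)
    (i : Fin (2 * n)) (hi : (i : ℕ) < n) (y : Fin n → k) (hy : y ≠ 0) :
    ¬(iotaHat k n y i ≠ 0 ∧ ∀ j : Fin (2 * n), i < j → iotaHat k n y j = 0) := by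
  rintro ⟨h0, h⟩
  by_cases h1 : (i : ℕ) < n - 1
  · have hj := h ⟨2 * n - ((i : ℕ) + 1), by omega⟩ (by
      rw [Fin.lt_def]
      show (i : ℕ) < 2 * n - ((i : ℕ) + 1)
      omega)
    apply h0
    unfold iotaHat at hj ⊢
    rw [dif_pos h1]
    rw [dif_neg (by simp only; omega), dif_neg (by simp only; omega),
      dif_neg (by simp only; omega), neg_eq_zero] at hj
    rw [← hj]
    congr 1
    apply Fin.ext
    simp only
    omega
  · apply h0
    unfold iotaHat
    rw [dif_neg h1, dif_pos (by omega)]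
end

section
/- Let k be a field and n ≥ 1 an integer. Define ι̂ : k^n → k^{2n} (coordinates indexed 0, …, 2n−1) by ι̂(y_0, …, y_{n−1}) = (y_1, y_2, …, y_{n−1}, 0, y_0 − (y_1 + ⋯ + y_{n−1}), −y_{n−1}, −y_{n−2}, …, −y_1). For 0 ≤ i ≤ 2n−1 let C_i ⊆ k^{2n} be the set of vectors v with v_i ≠ 0 and v_j = 0 for all j > i. Then for every nonzero y ∈ k^n: ι̂(y) ∈ C_n if and only if y_1 = y_2 = ⋯ = y_{n−1} = 0. -/
/-- For nonzero `y`, `ι̂(y)` lies in the Bruhat cell `C_n`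
(the set of vectors `v` with `v_n ≠ 0` and `v_j = 0` for all `j > n`) if and only
if `y_1 = ⋯ = y_{n−1} = 0`. -/
theorem stmt11 (k : Type*) [Field k] (n : ℕ) (hn : 1 ≤ n)
    (y : Fin n → k) (hy : y ≠ 0) :
    (iotaHat k n y ⟨n, by omega⟩ ≠ 0 ∧
      ∀ j : Fin (2 * n), (⟨n, by omega⟩ : Fin (2 * n)) < j → iotaHat k n y j = 0) ↔
    (∀ m : Fin n, 1 ≤ (m : ℕ) → y m = 0) := by
  have htail : ∀ j : Fin (2 * n), ∀ h : n < (j : ℕ),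
      iotaHat k n y j = -y ⟨2 * n - (j : ℕ), by omega⟩ := by
    intro j h
    unfold iotaHat
    rw [dif_neg (by omega), dif_neg (by omega), dif_neg (by omega)]
  have hmid : iotaHat k n y ⟨n, by omega⟩ = y ⟨0, by omega⟩ -
      ∑ m : Fin (n - 1), y ⟨(m : ℕ) + 1, by omega⟩ := by
    unfold iotaHat
    rw [dif_neg (by simp), dif_neg (by simp; omega), dif_pos rfl]
  constructor
  · rintro ⟨-, h⟩ m hm
    have hlt : n < 2 * n - (m : ℕ) := by omega
    have h1 := h ⟨2 * n - (m : ℕ), by omega⟩ hlt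
    rw [htail _ hlt, neg_eq_zero] at h1
    have e : (⟨2 * n - (2 * n - (m : ℕ)), by omega⟩ : Fin n) = m := by
      apply Fin.ext
      simp only
      omega
    rw [← e]
    exact h1
  · intro h
    constructor
    · rw [hmid, Finset.sum_eq_zero (fun m _ => h _ (by simp)), sub_zero]
      intro h0
      apply hy
      funext m
      by_cases hm : 1 ≤ (m : ℕ)
      · exact h m hm
      · have e : m = ⟨0, by omega⟩ := by
          apply Fin.ext
          simp only
          omega
        rw [e]
        exact h0
    · intro j hj
      have hj' : n < (j : ℕ) := hj
      rw [htail j hj', h _ (by simp only; omega), neg_zero]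
end

section
/- Fix integers n ≥ 2 and d ≥ 1 and a finite set Ψ of cardinality d with distinguished element τ₀. Then for every κ ∈ 𝒞 there exist unique integers a_0 and a_{1,τ₀}, and unique nonnegative integers a_w, a_{n+1,τ₀}, and a_{i,τ} for all pairs (i,τ) with 1 ≤ i ≤ n, τ ∈ Ψ and (i,τ) ≠ (1,τ₀), such that κ = a_0·μ_0 + a_w·μ_w + a_{n+1,τ₀}·μ_{n+1,τ₀} + Σ_{i=1}^{n} Σ_{τ∈Ψ} a_{i,τ}·μ_{i,τ} (componentwise addition of weights). -/
/- A weight is a pair `(κ_0, (κ_{i,τ}))` in `ℤ × (Ψ → Fin (2*n) → ℤ)`, with the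
`Fin (2*n)` coordinate 0-based (so the 1-based index `i` of the paper is `i-1`
here).  The generators `μ_0, μ_w, μ_{n+1,τ₀}, μ_{i,τ}` are as in the appendix on
branching laws. -/

/-- The generator `μ_0` (entry `1` in the `GL_1`-component). -/
def mu0 (n : ℕ) (Ψ : Type*) : ℤ × (Ψ → Fin (2 * n) → ℤ) := (1, 0)

/-- The generator `μ_w`: entry `−1` at `(i, τ₀)` for 1-based `n+1 ≤ i ≤ 2n`. -/
def muW (n : ℕ) {Ψ : Type*} [DecidableEq Ψ] (τ₀ : Ψ) : ℤ × (Ψ → Fin (2 * n) → ℤ) :=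
  (0, fun τ k => if τ = τ₀ ∧ n ≤ (k : ℕ) then -1 else 0)

/-- The generator `μ_{n+1,τ₀}`: entry `1` at `(k, τ₀)` for 1-based `2 ≤ k ≤ n`,
entry `−1` at `(k, τ₀)` for 1-based `n+1 ≤ k ≤ 2n`. -/
def muNp1 (n : ℕ) {Ψ : Type*} [DecidableEq Ψ] (τ₀ : Ψ) : ℤ × (Ψ → Fin (2 * n) → ℤ) :=
  (0, fun τ k => if τ = τ₀ then
        (if 1 ≤ (k : ℕ) ∧ (k : ℕ) < n then 1 else if n ≤ (k : ℕ) then -1 else 0)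
      else 0)

/-- The generators `μ_{i,τ}` for `1 ≤ i ≤ n` (here `i : Fin n` is the 1-based
index `i+1`): for `τ = τ₀`, `μ_{1,τ₀}` has entry `1` at `(1,τ₀)` and, for
`2 ≤ i`, `μ_{i,τ₀}` has entry `1` at `(k,τ₀)` for 1-based `2 ≤ k ≤ i` and entry
`−1` at `(k,τ₀)` for 1-based `2n+2−i ≤ k ≤ 2n`; for `τ ≠ τ₀`, `μ_{i,τ}` has
entry `1` at `(k,τ)` for 1-based `1 ≤ k ≤ i` and entry `−1` at `(k,τ)` for
1-based `2n+1−i ≤ k ≤ 2n`. -/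
def muGen (n : ℕ) {Ψ : Type*} [DecidableEq Ψ] (τ₀ τ : Ψ) (i : Fin n) :
    ℤ × (Ψ → Fin (2 * n) → ℤ) :=
  (0, fun τ' k =>
    if τ' = τ then
      (if τ = τ₀ then
        (if (i : ℕ) = 0 then (if (k : ℕ) = 0 then 1 else 0)
         else
          (if 1 ≤ (k : ℕ) ∧ (k : ℕ) ≤ (i : ℕ) then 1
           else if 2 * n - (i : ℕ) ≤ (k : ℕ) then -1 else 0))
      else
        (if (k : ℕ) ≤ (i : ℕ) then 1
         else if 2 * n - 1 - (i : ℕ) ≤ (k : ℕ) then -1 else 0))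
    else 0)

/-- Tail sums. -/
def tailS (n : ℕ) (c : Fin n → ℤ) (k : ℕ) : ℤ := ∑ i : Fin n, if k ≤ (i : ℕ) then c i else 0

lemma tailS_top (n : ℕ) (c : Fin n → ℤ) : tailS n c n = 0 := by
  unfold tailS
  apply Finset.sum_eq_zero
  intro i _
  have := i.isLt
  rw [if_neg (by omega)]

lemma tailS_succ (n : ℕ) (c : Fin n → ℤ) (k : ℕ) (h : k < n) :
    tailS n c k = c ⟨k, h⟩ + tailS n c (k + 1) := by
  unfold tailS
  have : c ⟨k, h⟩ = ∑ i : Fin n, if i = ⟨k, h⟩ then c i else 0 := by simp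
  rw [this, ← Finset.sum_add_distrib]
  apply Finset.sum_congr rfl
  intro i _
  by_cases h1 : i = ⟨k, h⟩
  · subst h1; simp
  · have h2 : (i : ℕ) ≠ k := fun e => h1 (Fin.ext e)
    rw [if_neg h1]
    by_cases h3 : k ≤ (i : ℕ)
    · rw [if_pos h3, if_pos (by omega)]; simp
    · rw [if_neg h3, if_neg (by omega)]; simp

lemma tailS_tel (n m : ℕ) (c : Fin n → ℤ) (g : ℕ → ℤ) (hg : g n = 0)
    (hc : ∀ k (h : k < n), m ≤ k → c ⟨k, h⟩ = g k - g (k + 1)) :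
    ∀ j k, j + k = n → m ≤ k → tailS n c k = g k := by
  intro j
  induction j with
  | zero => intro k hk _; obtain rfl : k = n := by omega
            rw [tailS_top, hg]
  | succ j ih =>
    intro k hk hm
    rw [tailS_succ n c k (by omega), ih (k + 1) (by omega) (by omega), hc k (by omega) hm]
    ring

lemma comp_eq (n : ℕ) (Ψ : Type*) [Fintype Ψ] [DecidableEq Ψ] (τ₀ : Ψ)
    (κ : ℤ × (Ψ → Fin (2 * n) → ℤ)) (z a b : ℤ) (c : Ψ → Fin n → ℤ) :
    κ = z • mu0 n Ψ + a • muW n τ₀ + b • muNp1 n τ₀ +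
        ∑ τ : Ψ, ∑ i : Fin n, c τ i • muGen n τ₀ τ i ↔
    κ.1 = z ∧ ∀ τ k, κ.2 τ k = a * (muW n τ₀).2 τ k + b * (muNp1 n τ₀).2 τ k +
      ∑ i : Fin n, c τ i * (muGen n τ₀ τ i).2 τ k := by
  have key : ∀ τ k, (∑ τ' : Ψ, ∑ i : Fin n, c τ' i * (muGen n τ₀ τ' i).2 τ k) =
      ∑ i : Fin n, c τ i * (muGen n τ₀ τ i).2 τ k := by
    intro τ k
    apply Finset.sum_eq_single τ
    · intro τ' _ h
      apply Finset.sum_eq_zero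
      intro i _
      simp [muGen, Ne.symm h]
    · simp
  rw [Prod.ext_iff, funext_iff]
  simp only [funext_iff]
  apply and_congr
  · simp [mu0, muW, muNp1, muGen, Prod.fst_sum]
  · apply forall_congr'; intro τ
    apply forall_congr'; intro k
    rw [← key]
    simp [mu0, Prod.snd_sum, Finset.sum_apply]

lemma sum_ne (n : ℕ) (Ψ : Type*) [DecidableEq Ψ] (τ₀ τ : Ψ) (h : τ ≠ τ₀) (c : Fin n → ℤ)
    (k : Fin (2 * n)) :
    ∑ i : Fin n, c i * (muGen n τ₀ τ i).2 τ k =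
      if (k : ℕ) < n then tailS n c k else - tailS n c (2 * n - 1 - k) := by
  have hk := k.isLt
  split_ifs with h1
  · unfold tailS
    apply Finset.sum_congr rfl
    intro i _
    have := i.isLt
    simp only [muGen, if_true, if_neg h]
    split_ifs <;> first | omega | simp
  · unfold tailS
    rw [← Finset.sum_neg_distrib]
    apply Finset.sum_congr rfl
    intro i _
    have := i.isLt
    simp only [muGen, if_true, if_neg h]
    split_ifs <;> first | omega | simp

lemma sum_eq (n : ℕ) (Ψ : Type*) [DecidableEq Ψ] (τ₀ : Ψ) (hn : 2 ≤ n) (c : Fin n → ℤ)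
    (k : Fin (2 * n)) :
    ∑ i : Fin n, c i * (muGen n τ₀ τ₀ i).2 τ₀ k =
      if (k : ℕ) = 0 then c ⟨0, by omega⟩ else
      if (k : ℕ) < n then tailS n c k else - tailS n c (2 * n - k) := by
  have hk := k.isLt
  split_ifs with h0 h1
  · rw [Finset.sum_eq_single (⟨0, by omega⟩ : Fin n)]
    · simp [muGen, h0]
    · intro i _ hi
      have h2 : (i : ℕ) ≠ 0 := fun e => hi (Fin.ext e)
      have := i.isLt
      simp only [muGen, if_true]
      split_ifs <;> first | omega | simp
    · simp
  · unfold tailS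
    apply Finset.sum_congr rfl
    intro i _
    have := i.isLt
    simp only [muGen, if_true]
    split_ifs <;> first | omega | simp
  · unfold tailS
    rw [← Finset.sum_neg_distrib]
    apply Finset.sum_congr rfl
    intro i _
    have := i.isLt
    simp only [muGen, if_true]
    split_ifs <;> first | omega | simp

lemma comp_iff (n : ℕ) (hn : 2 ≤ n) (Ψ : Type*) [Fintype Ψ] [DecidableEq Ψ] (τ₀ : Ψ)
    (κ : ℤ × (Ψ → Fin (2 * n) → ℤ)) (z a b : ℤ) (c : Ψ → Fin n → ℤ) :
    κ = z • mu0 n Ψ + a • muW n τ₀ + b • muNp1 n τ₀ +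
        ∑ τ : Ψ, ∑ i : Fin n, c τ i • muGen n τ₀ τ i ↔
    κ.1 = z ∧ (∀ k : Fin (2 * n), κ.2 τ₀ k =
      if (k : ℕ) = 0 then c τ₀ ⟨0, by omega⟩ else
      if (k : ℕ) < n then b + tailS n (c τ₀) k else - a - b - tailS n (c τ₀) (2 * n - k)) ∧
     (∀ τ, τ ≠ τ₀ → ∀ k : Fin (2 * n), κ.2 τ k =
      if (k : ℕ) < n then tailS n (c τ) k else - tailS n (c τ) (2 * n - 1 - k)) := by
  rw [comp_eq]
  apply and_congr Iff.rfl
  have e0 : ∀ k : Fin (2 * n), a * (muW n τ₀).2 τ₀ k + b * (muNp1 n τ₀).2 τ₀ k +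
      ∑ i : Fin n, c τ₀ i * (muGen n τ₀ τ₀ i).2 τ₀ k =
      if (k : ℕ) = 0 then c τ₀ ⟨0, by omega⟩ else
      if (k : ℕ) < n then b + tailS n (c τ₀) k else
        - a - b - tailS n (c τ₀) (2 * n - k) := by
    intro k
    rw [sum_eq n Ψ τ₀ hn]
    simp only [muW, muNp1, if_true, true_and]
    split_ifs <;> first | omega | (simp; done) | ring
  have e1 : ∀ τ, τ ≠ τ₀ → ∀ k : Fin (2 * n),
      a * (muW n τ₀).2 τ k + b * (muNp1 n τ₀).2 τ k +
      ∑ i : Fin n, c τ i * (muGen n τ₀ τ i).2 τ k =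
      if (k : ℕ) < n then tailS n (c τ) k else - tailS n (c τ) (2 * n - 1 - k) := by
    intro τ h k
    rw [sum_ne n Ψ τ₀ τ h]
    simp [muW, muNp1, h]
  constructor
  · intro H
    exact ⟨fun k => (H τ₀ k).trans (e0 k), fun τ h k => (H τ k).trans (e1 τ h k)⟩
  · rintro ⟨H0, H1⟩ τ k
    by_cases h : τ = τ₀
    · subst h; exact (H0 k).trans (e0 k).symm
    · exact (H1 τ h k).trans (e1 τ h k).symm

/-- Every weight `κ ∈ 𝒞` (i.e. `M_G`-dominant, pure of some
weight `w ≤ 0`, with `κ_{n+1,τ₀} ≤ w`) decomposes uniquely as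
`κ = a_0·μ_0 + a_w·μ_w + a_{n+1,τ₀}·μ_{n+1,τ₀} + Σ_{i=1}^{n} Σ_{τ∈Ψ} a_{i,τ}·μ_{i,τ}`
with `a_0, a_{1,τ₀} ∈ ℤ` and all other coefficients nonnegative. -/
theorem stmt15 (n d : ℕ) (hn : 2 ≤ n) (hd : 1 ≤ d)
    (Ψ : Type*) [Fintype Ψ] [DecidableEq Ψ] (hΨ : Fintype.card Ψ = d) (τ₀ : Ψ)
    (κ : ℤ × (Ψ → Fin (2 * n) → ℤ))
    (hdom₀ : ∀ i j : Fin (2 * n), 1 ≤ (i : ℕ) → (i : ℕ) ≤ (j : ℕ) →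
      κ.2 τ₀ j ≤ κ.2 τ₀ i)
    (hdom : ∀ τ : Ψ, τ ≠ τ₀ → ∀ i j : Fin (2 * n), (i : ℕ) ≤ (j : ℕ) →
      κ.2 τ j ≤ κ.2 τ i)
    (w : ℤ) (hw : w ≤ 0)
    (hpure₀ : ∀ i : Fin (2 * n), ∀ _h1 : 1 ≤ (i : ℕ), ∀ _h2 : (i : ℕ) < n,
      κ.2 τ₀ i + κ.2 τ₀ ⟨2 * n - (i : ℕ), by have := i.isLt; omega⟩ = w)
    (hpure : ∀ τ : Ψ, τ ≠ τ₀ → ∀ i : Fin (2 * n), κ.2 τ i + κ.2 τ i.rev = 0)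
    (hmid : κ.2 τ₀ ⟨n, by omega⟩ ≤ w) :
    ∃! Z : ℤ × ℤ × ℤ × (Ψ → Fin n → ℤ),
      (0 ≤ Z.2.1 ∧ 0 ≤ Z.2.2.1 ∧
        (∀ (τ : Ψ) (i : Fin n), (τ ≠ τ₀ ∨ (i : ℕ) ≠ 0) → 0 ≤ Z.2.2.2 τ i)) ∧
      κ = Z.1 • mu0 n Ψ + Z.2.1 • muW n τ₀ + Z.2.2.1 • muNp1 n τ₀ +
        ∑ τ : Ψ, ∑ i : Fin n, Z.2.2.2 τ i • muGen n τ₀ τ i := by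
  -- total extension
  obtain ⟨x, hx⟩ : ∃ x : Ψ → ℕ → ℤ, ∀ τ (k : Fin (2 * n)), κ.2 τ k = x τ k :=
    ⟨fun τ k => if h : k < 2 * n then κ.2 τ ⟨k, h⟩ else 0, fun τ k => by simp⟩
  simp only [comp_iff n hn, hx] at *
  have hdom₀' : ∀ i j : ℕ, 1 ≤ i → i ≤ j → j < 2 * n → x τ₀ j ≤ x τ₀ i := fun i j h1 h2 h3 =>
    hdom₀ ⟨i, by omega⟩ ⟨j, h3⟩ h1 h2
  have hdom' : ∀ τ, τ ≠ τ₀ → ∀ i j : ℕ, i ≤ j → j < 2 * n → x τ j ≤ x τ i :=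
    fun τ h i j h2 h3 => hdom τ h ⟨i, by omega⟩ ⟨j, h3⟩ h2
  have hpure₀' : ∀ i : ℕ, 1 ≤ i → i < n → x τ₀ i + x τ₀ (2 * n - i) = w := fun i h1 h2 =>
    hpure₀ ⟨i, by omega⟩ h1 h2
  have hpure' : ∀ τ, τ ≠ τ₀ → ∀ i : ℕ, i < 2 * n → x τ i + x τ (2 * n - 1 - i) = 0 := by
    intro τ h i h1
    have := hpure τ h ⟨i, h1⟩
    rw [Fin.val_rev] at this
    simpa [Nat.sub_sub, Nat.add_comm] using this
  let g : Ψ → ℕ → ℤ := fun τ k => if n ≤ k then 0 else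
    if τ = τ₀ then x τ₀ k - (w - x τ₀ n) else x τ k
  let c : Ψ → Fin n → ℤ := fun τ i => if τ = τ₀ ∧ (i : ℕ) = 0 then x τ₀ 0 else
    g τ i - g τ (i + 1)
  have hS : ∀ τ k, k ≤ n → (τ ≠ τ₀ ∨ 1 ≤ k) → tailS n (c τ) k = g τ k := by
    intro τ k hk h
    refine tailS_tel n k (c τ) (g τ) (by simp [g]) ?_ (n - k) k (by omega) le_rfl
    intro j hj hkj
    have : ¬ (τ = τ₀ ∧ j = 0) := by
      rintro ⟨h1, h2⟩
      rcases h with h | h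
      · exact h h1
      · omega
    simp only [c, if_neg this]
  refine ⟨(κ.1, -w, w - x τ₀ n, c), ⟨⟨by simpa using hw, by simpa using hmid, ?_⟩, rfl, ?_, ?_⟩, ?_⟩
  · intro τ i h
    have hi := i.isLt
    by_cases ht : τ = τ₀
    · subst ht
      have h0 : (i : ℕ) ≠ 0 := by simpa using h
      simp only [c, g, h0, and_false, if_false, if_true]
      have h1 := hdom₀' i (i + 1) (by omega) (by omega) (by omega)
      have h2 := hdom₀' n (n + 1) (by omega) (by omega) (by omega)
      have h3 := hpure₀' (n - 1) (by omega) (by omega)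
      rw [show 2 * n - (n - 1) = n + 1 by omega] at h3
      rw [if_neg (by omega)]
      split_ifs with h4
      · have : (i : ℕ) = n - 1 := by omega
        rw [this]; omega
      · omega
    · simp only [c, g, ht, false_and, if_false]
      have h1 := hdom' τ ht i (i + 1) (by omega) (by omega)
      have h3 := hpure' τ ht (n - 1) (by omega)
      rw [show 2 * n - 1 - (n - 1) = n by omega] at h3
      rw [if_neg (by omega)]
      split_ifs with h4
      · have h5 : (i : ℕ) = n - 1 := by omega
        rw [h5, show n - 1 + 1 = n by omega] at h1
        rw [h5]; omega
      · omega
  · intro k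
    have hk := k.isLt
    split_ifs with h0 h1
    · simp [c, h0]
    · dsimp only
      rw [hS τ₀ k (by omega) (Or.inr (by omega))]
      simp only [g, if_true]
      rw [if_neg (by omega)]; ring
    · dsimp only
      rw [hS τ₀ _ (by omega) (Or.inr (by omega))]
      simp only [g, if_true]
      split_ifs with h2
      · have : (k : ℕ) = n := by omega
        rw [this]; ring
      · have := hpure₀' (2 * n - k) (by omega) (by omega)
        rw [show 2 * n - (2 * n - (k : ℕ)) = k by omega] at this
        linarith
  · intro τ ht k
    have hk := k.isLt
    split_ifs with h1
    · dsimp only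
      rw [hS τ k (by omega) (Or.inl ht)]
      simp only [g, if_neg ht]
      rw [if_neg (by omega)]
    · dsimp only
      rw [hS τ _ (by omega) (Or.inl ht)]
      simp only [g, if_neg ht]
      rw [if_neg (by omega)]
      linarith [hpure' τ ht k hk]
  · rintro ⟨z, a, b, c'⟩ ⟨-, hz, H0, H1⟩
    dsimp only at hz H0 H1
    have en : x τ₀ n = - a - b := by
      have := H0 ⟨n, by omega⟩
      simp only [lt_irrefl, if_false] at this
      rw [if_neg (by omega), show 2 * n - n = n by omega, tailS_top] at this
      linarith
    have lo : ∀ k, 1 ≤ k → k < n → x τ₀ k = b + tailS n (c' τ₀) k := by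
      intro k h1 h2
      have := H0 ⟨k, by omega⟩
      simp only [] at this
      rwa [if_neg (by omega), if_pos h2] at this
    have hi := H0 ⟨n + 1, by omega⟩
    simp only [] at hi
    rw [if_neg (by omega), if_neg (by omega), show 2 * n - (n + 1) = n - 1 by omega] at hi
    have hp := hpure₀' (n - 1) (by omega) (by omega)
    rw [show 2 * n - (n - 1) = n + 1 by omega] at hp
    have hl := lo (n - 1) (by omega) (by omega)
    have ea : a = -w := by linarith
    have eb : b = w - x τ₀ n := by linarith
    have hS' : ∀ τ k, k ≤ n → (τ ≠ τ₀ ∨ 1 ≤ k) → tailS n (c' τ) k = g τ k := by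
      intro τ k hk h
      rcases Nat.eq_or_lt_of_le hk with h1 | h1
      · rw [h1, tailS_top]; simp [g]
      · by_cases ht : τ = τ₀
        · subst ht
          have hk1 : 1 ≤ k := by simpa using h
          simp only [g, if_true]
          rw [if_neg (by omega)]
          linarith [lo k hk1 h1]
        · have := H1 τ ht ⟨k, by omega⟩
          simp only [] at this
          rw [if_pos h1] at this
          simp only [g, if_neg ht]
          rw [if_neg (by omega), this]
    have ec : c' = c := by
      funext τ i
      have hi := i.isLt
      by_cases h : τ = τ₀ ∧ (i : ℕ) = 0
      · have e : i = ⟨0, by omega⟩ := Fin.ext h.2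
        have := H0 ⟨0, by omega⟩
        simp only [if_true] at this
        simp only [c, if_pos h]
        rw [this, h.1, e]
      · have h' : τ ≠ τ₀ ∨ 1 ≤ (i : ℕ) := by
          by_cases ht : τ = τ₀
          · right
            have : (i : ℕ) ≠ 0 := fun e => h ⟨ht, e⟩
            omega
          · exact Or.inl ht
        have e1 := tailS_succ n (c' τ) i hi
        rw [hS' τ i (by omega) h', hS' τ (i + 1) (by omega) (Or.inr (by omega))] at e1
        simp only [c, if_neg h]
        simp only [Fin.eta] at e1
        linarith
    rw [hz, ea, eb, ec]
end

section
/- Let n ≥ 1 and let c_1 ≥ c_2 ≥ … ≥ c_{2n} be integers with c_j + c_{2n+1−j} = 0 for all 1 ≤ j ≤ 2n. Define μ ∈ ℚ^{2n} by μ_j = c_j + (2n+1−2j)/2. For 0 ≤ i ≤ 2n−1 let w_i act on 2n-tuples by the shuffle w_i·(a_1, …, a_{2n}) = (a_{i+1}, a_1, a_2, …, a_i, a_{i+2}, …, a_{2n}) (so w_0 is the identity), with inverse w_i^{-1}·(a_1, …, a_{2n}) = (a_2, a_3, …, a_{i+1}, a_1, a_{i+2}, …, a_{2n}), and set δ_i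 = w_i^{-1}·(w_n·μ) − μ ∈ ℚ^{2n}. Then: (a) for every 0 ≤ i ≤ n−1, the sum of the last n coordinates of δ_i equals 2c_n + 1; (b) for every 1 ≤ ε ≤ n−1, the sum of the last n−ε coordinates of δ_{n+ε} equals c_{n−ε} − c_n + ε. In particular, for every 0 ≤ i ≤ 2n−1 with i ≠ n there exists 1 ≤ j ≤ 2n−1 such that the sum of the last j coordinates of δ_i is strictly positive. -/
/- The vectors are indexed by `Fin (2*n)` (0-based; the 1-based index `j` of the
paper is `j-1` here). -/

/-- `μ_j = c_j + (2n+1−2j)/2` (1-based `j`). -/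
def muVec (n : ℕ) (c : Fin (2 * n) → ℤ) : Fin (2 * n) → ℚ := fun j =>
  (c j : ℚ) + (2 * (n : ℚ) + 1 - 2 * ((j : ℕ) + 1)) / 2

/-- The shuffle `w_i · (a_1, …, a_{2n}) = (a_{i+1}, a_1, …, a_i, a_{i+2}, …, a_{2n})`
(1-based), for `i = (i : Fin (2*n))` (0-based value `= i`). -/
def shuffle (n : ℕ) (i : Fin (2 * n)) (a : Fin (2 * n) → ℚ) : Fin (2 * n) → ℚ :=
  fun k =>
    if (k : ℕ) = 0 then a i
    else if (k : ℕ) ≤ (i : ℕ) then a ⟨(k : ℕ) - 1, by have := k.isLt; omega⟩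
    else a k

/-- The inverse shuffle
`w_i⁻¹ · (a_1, …, a_{2n}) = (a_2, …, a_{i+1}, a_1, a_{i+2}, …, a_{2n})` (1-based). -/
def shuffleInv (n : ℕ) (i : Fin (2 * n)) (a : Fin (2 * n) → ℚ) : Fin (2 * n) → ℚ :=
  fun k =>
    if h : (k : ℕ) < (i : ℕ) then a ⟨(k : ℕ) + 1, by have := i.isLt; omega⟩
    else if (k : ℕ) = (i : ℕ) then a ⟨0, by have := i.isLt; omega⟩
    else a k

/-- `δ_i = w_i⁻¹ · (w_n · μ) − μ`. -/
def delta (n : ℕ) (hn : 0 < n) (c : Fin (2 * n) → ℤ) (i : Fin (2 * n)) :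
    Fin (2 * n) → ℚ :=
  shuffleInv n i (shuffle n ⟨n, by omega⟩ (muVec n c)) - muVec n c

/-- With `c_1 ≥ ⋯ ≥ c_{2n}`, `c_j + c_{2n+1−j} = 0`,
`μ_j = c_j + (2n+1−2j)/2` and `δ_i = w_i⁻¹·(w_n·μ) − μ`:
(a) for `0 ≤ i ≤ n−1` the sum of the last `n` coordinates of `δ_i` is `2c_n + 1`;
(b) for `1 ≤ ε ≤ n−1` the sum of the last `n−ε` coordinates of `δ_{n+ε}` is
`c_{n−ε} − c_n + ε`; in particular, for every `i ≠ n` there is `1 ≤ j ≤ 2n−1`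
such that the sum of the last `j` coordinates of `δ_i` is strictly positive. -/
theorem stmt17 (n : ℕ) (hn : 1 ≤ n) (c : Fin (2 * n) → ℤ)
    (hanti : ∀ j k : Fin (2 * n), (j : ℕ) ≤ (k : ℕ) → c k ≤ c j)
    (hdual : ∀ j : Fin (2 * n), c j + c j.rev = 0) :
    (∀ i : Fin (2 * n), (i : ℕ) < n →
      ∑ k ∈ Finset.univ.filter (fun k : Fin (2 * n) => n ≤ (k : ℕ)),
          delta n (by omega) c i k
        = 2 * (c ⟨n - 1, by omega⟩ : ℚ) + 1) ∧
    (∀ ε : ℕ, ∀ _h1 : 1 ≤ ε, ∀ _h2 : ε ≤ n - 1,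
      ∑ k ∈ Finset.univ.filter (fun k : Fin (2 * n) => n + ε ≤ (k : ℕ)),
          delta n (by omega) c ⟨n + ε, by omega⟩ k
        = (c ⟨n - ε - 1, by omega⟩ : ℚ) - (c ⟨n - 1, by omega⟩ : ℚ) + ε) ∧
    (∀ i : Fin (2 * n), (i : ℕ) ≠ n →
      ∃ j : ℕ, 1 ≤ j ∧ j ≤ 2 * n - 1 ∧
        0 < ∑ k ∈ Finset.univ.filter (fun k : Fin (2 * n) => 2 * n - j ≤ (k : ℕ)),
          delta n (by omega) c i k) := by
  have hrev : ∀ (a b : ℕ) (ha : a < 2 * n) (hb : b < 2 * n), a + b + 1 = 2 * n →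
      (c ⟨a, ha⟩ : ℚ) = - (c ⟨b, hb⟩ : ℚ) := by
    intro a b ha hb hab
    have h := hdual ⟨a, ha⟩
    have e : (⟨a, ha⟩ : Fin (2 * n)).rev = ⟨b, hb⟩ := by
      apply Fin.ext
      simp only [Fin.val_rev]
      omega
    rw [e] at h
    have h' : c ⟨a, ha⟩ = - c ⟨b, hb⟩ := by omega
    rw [h']
    push_cast
    ring
  have hA : ∀ i : Fin (2 * n), (i : ℕ) < n →
      ∑ k ∈ Finset.univ.filter (fun k : Fin (2 * n) => n ≤ (k : ℕ)),
          delta n (by omega) c i k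
        = 2 * (c ⟨n - 1, by omega⟩ : ℚ) + 1 := by
    intro i hi
    rw [Finset.sum_eq_single (⟨n, by omega⟩ : Fin (2 * n))]
    · have h1 : ¬ (n < (i : ℕ)) := by omega
      have h2 : ¬ (n = (i : ℕ)) := by omega
      have h3 : ¬ (n = 0) := by omega
      simp only [delta, Pi.sub_apply, shuffleInv, shuffle, muVec, h1, h2, h3, dite_false,
        if_false, le_refl, if_true]
      rw [hrev n (n - 1) (by omega) (by omega) (by omega)]
      push_cast [Nat.cast_sub hn]
      ring
    · intro k hk hne
      have hk' : n ≤ (k : ℕ) := by simpa using hk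
      have hne' : (k : ℕ) ≠ n := fun h => hne (Fin.ext h)
      have h1 : ¬ ((k : ℕ) < (i : ℕ)) := by omega
      have h2 : ¬ ((k : ℕ) = (i : ℕ)) := by omega
      have h3 : ¬ ((k : ℕ) = 0) := by omega
      have h4 : ¬ ((k : ℕ) ≤ n) := by omega
      simp only [delta, Pi.sub_apply, shuffleInv, shuffle, h1, h2, h3, h4, dite_false,
        if_false, sub_self]
    · intro h
      simp at h
  have hB : ∀ ε : ℕ, ∀ _h1 : 1 ≤ ε, ∀ _h2 : ε ≤ n - 1,
      ∑ k ∈ Finset.univ.filter (fun k : Fin (2 * n) => n + ε ≤ (k : ℕ)),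
          delta n (by omega) c ⟨n + ε, by omega⟩ k
        = (c ⟨n - ε - 1, by omega⟩ : ℚ) - (c ⟨n - 1, by omega⟩ : ℚ) + ε := by
    intro ε h1 h2
    rw [Finset.sum_eq_single (⟨n + ε, by omega⟩ : Fin (2 * n))]
    · simp only [delta, Pi.sub_apply, shuffleInv, shuffle, muVec, lt_irrefl, dite_false,
        if_true]
      rw [hrev n (n - 1) (by omega) (by omega) (by omega),
        hrev (n + ε) (n - ε - 1) (by omega) (by omega) (by omega)]
      push_cast
      ring
    · intro k hk hne
      have hk' : n + ε ≤ (k : ℕ) := by simpa using hk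
      have hne' : (k : ℕ) ≠ n + ε := fun h => hne (Fin.ext h)
      have h1 : ¬ ((k : ℕ) < n + ε) := by omega
      have h3 : ¬ ((k : ℕ) = 0) := by omega
      have h4 : ¬ ((k : ℕ) ≤ n) := by omega
      simp only [delta, Pi.sub_apply, shuffleInv, shuffle, h1, hne', h3, h4, dite_false,
        if_false, sub_self]
    · intro h
      simp at h
  refine ⟨hA, hB, ?_⟩
  intro i hi
  rcases lt_or_gt_of_ne hi with h | h
  · refine ⟨n, hn, by omega, ?_⟩
    have e : 2 * n - n = n := by omega
    rw [e, hA i h]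
    have h1 := hrev n (n - 1) (by omega) (by omega) (by omega)
    have h2 : (c ⟨n, by omega⟩ : ℚ) ≤ c ⟨n - 1, by omega⟩ := by
      exact_mod_cast hanti ⟨n - 1, by omega⟩ ⟨n, by omega⟩ (Nat.sub_le n 1)
    linarith
  · obtain ⟨ε, hε⟩ : ∃ ε, (i : ℕ) = n + ε := ⟨i - n, by omega⟩
    have hlt := i.isLt
    refine ⟨n - ε, by omega, by omega, ?_⟩
    have e : 2 * n - (n - ε) = n + ε := by omega
    have ei : i = ⟨n + ε, by omega⟩ := Fin.ext hε
    rw [e, ei, hB ε (by omega) (by omega)]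
    have h2 : (c ⟨n - 1, by omega⟩ : ℚ) ≤ c ⟨n - ε - 1, by omega⟩ := by
      exact_mod_cast hanti ⟨n - ε - 1, by omega⟩ ⟨n - 1, by omega⟩
        (by show n - ε - 1 ≤ n - 1; omega)
    have h3 : (1 : ℚ) ≤ ε := by
      have : 1 ≤ ε := by omega
      exact_mod_cast this
    linarith
end
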